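/- arXiv:2504.18293 — 4 statements merged into one kernel-verified Lean document; each statement's English description precedes it below -/
import Mathlib

section
/- Let k be a perfect field, K/k a finite Galois extension of degree n with K = k(α), where α has minimal polynomial f_K ∈ k[x] of degree n, and let Ω be a field extension of k containing K. Let L be an intermediate field of Ω/k such that f_K remains irreducible in L[x]. Then the norm form N_{K/k,α} remains irreducible as an element of L[x₀,…,x_{n−1}], and it coincides with the norm form N_{LK/L,α} of the compositum extension LK/L. -/
open Polynomial IntermediateField

/-- The linear form `x₀ + β x₁ + ⋯ + β ^ (n - 1) x_{n - 1}`. -/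
noncomputable def powerForm {R : Type*} [CommSemiring R] (n : ℕ) (β : R) :
    MvPolynomial (Fin n) R :=
  ∑ i : Fin n, MvPolynomial.C (β ^ (i : ℕ)) * MvPolynomial.X i

theorem map_powerForm {R S : Type*} [CommSemiring R] [CommSemiring S] (φ : R →+* S) (n : ℕ)
    (β : R) : MvPolynomial.map φ (powerForm n β) = powerForm n (φ β) := by
  simp [powerForm]

theorem irreducible_powerForm {R : Type*} [CommRing R] [IsDomain R] {n : ℕ} (hn : 0 < n)
    (β : R) : Irreducible (powerForm n β) := by
  have h : powerForm n β =
      MvPolynomial.sumSMulX (Finsupp.equivFunOnFinite.symm fun i : Fin n ↦ β ^ (i : ℕ)) := by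
    simp [powerForm, MvPolynomial.sumSMulX, Finsupp.linearCombination_apply,
      Finsupp.sum_fintype, MvPolynomial.smul_eq_C_mul]
  rw [h]
  refine MvPolynomial.irreducible_sumSMulX _ ⟨⟨0, hn⟩, by simp⟩ fun r hr ↦ ?_
  exact isUnit_of_dvd_one (by simpa using hr ⟨0, hn⟩)

theorem eq_of_powerForm_dvd {R : Type*} [CommRing R] {n : ℕ} (hn : 1 < n) {β γ : R}
    (h : powerForm n β ∣ powerForm n γ) : β = γ := by
  let v : Fin n → R := Function.update (Pi.single ⟨1, hn⟩ 1) ⟨0, by lia⟩ (-β)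
  have hv (δ : R) : MvPolynomial.eval v (powerForm n δ) = δ - β := by
    obtain ⟨m, rfl⟩ : ∃ m, n = m + 2 := ⟨n - 2, by lia⟩
    have h0 : v 0 = -β := by simp [v]
    have h1 : v 1 = 1 := by
      simp only [v]
      rw [Function.update_of_ne (by simp)]
      exact Pi.single_eq_same _ _
    have h2 (i : Fin m) : v i.succ.succ = 0 := by
      simp only [v]
      rw [Function.update_of_ne (by simp [Fin.ext_iff]),
        Pi.single_eq_of_ne (by simp [Fin.ext_iff])]
    simp [powerForm, Fin.sum_univ_succ, h0, h1, h2]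
    ring
  have := map_dvd (MvPolynomial.eval v) h
  rw [hv, hv, sub_self, zero_dvd_iff, sub_eq_zero] at this
  exact this.symm

theorem MvPolynomial.isUnit_of_isUnit_map {σ F E : Type*} [Field F] [Field E] (φ : F →+* E)
    {p : MvPolynomial σ F} (h : IsUnit (MvPolynomial.map φ p)) : IsUnit p := by
  rw [MvPolynomial.isUnit_iff] at h ⊢
  simpa [MvPolynomial.coeff_map, ← map_pow] using h

theorem adjoin_simple_coe_eq_top {F Ω : Type*} [Field F] [Field Ω] [Algebra F Ω]
    {E : IntermediateField F Ω} {a : E} (h : E = F⟮(a : Ω)⟯) : F⟮a⟯ = ⊤ := by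
  apply lift_injective E
  rw [lift_adjoin_simple, lift_top, ← h]

theorem injective_algEquiv_apply {F E : Type*} [Field F] [Field E] [Algebra F E] {a : E}
    (h : F⟮a⟯ = ⊤) : Function.Injective fun σ : E ≃ₐ[F] E ↦ σ a := by
  intro σ τ hστ
  have : (σ : E →ₐ[F] E) = τ := by
    have hres := algHom_ext_of_eq_adjoin F h.symm
      (φ₁ := (σ : E →ₐ[F] E).comp (val ⊤)) (φ₂ := (τ : E →ₐ[F] E).comp (val ⊤))
      fun x hx ↦ by obtain rfl := hx; exact hστ
    ext x
    exact DFunLike.congr_fun hres ⟨x, mem_top⟩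
  exact AlgEquiv.coe_toAlgHom_injective this

theorem aroots_minpoly_eq_map_algEquiv {F E : Type*} [Field F] [Field E] [Algebra F E]
    [FiniteDimensional F E] [IsGalois F E] {a : E} (h : F⟮a⟯ = ⊤) :
    (minpoly F a).aroots E =
      (Finset.univ : Finset (E ≃ₐ[F] E)).val.map fun σ ↦ σ a := by
  refine (Multiset.Nodup.ext (nodup_roots (Separable.map (IsGalois.separable F a)))
    ((Multiset.nodup_map_iff_of_injective (injective_algEquiv_apply h)).2
      Finset.univ.nodup)).2 fun x ↦ ?_
  rw [← isConjRoot_iff_mem_minpoly_aroots (IsGalois.integral F a), IsConjRoot.comm,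
    isConjRoot_iff_exists_algEquiv]
  simp

theorem aroots_minpoly_eq_map_algEquiv_coe {F Ω : Type*} [Field F] [Field Ω] [Algebra F Ω]
    {E : IntermediateField F Ω} [FiniteDimensional F E] [IsGalois F E] {a : E}
    (h : E = F⟮(a : Ω)⟯) :
    (minpoly F (a : Ω)).aroots Ω =
      (Finset.univ : Finset (E ≃ₐ[F] E)).val.map fun σ ↦ (σ a : Ω) := by
  have hm : minpoly F (a : Ω) = minpoly F a :=
    minpoly.algebraMap_eq (algebraMap E Ω).injective a
  rw [hm, aroots_def, IsScalarTower.algebraMap_eq F E Ω, ← Polynomial.map_map,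
    (IsGalois.splits F a).roots_map, ← aroots_def,
    aroots_minpoly_eq_map_algEquiv (adjoin_simple_coe_eq_top h), Multiset.map_map]
  rfl

/-- A polynomial over `F` that becomes the product of the conjugates of `powerForm n a` over a
Galois extension `E = F(a)` of degree `n` is irreducible. -/
theorem irreducible_of_map_eq_prod_powerForm {F E : Type*} [Field F] [Field E] [Algebra F E]
    [FiniteDimensional F E] {a : E} (h : F⟮a⟯ = ⊤) {n : ℕ} (hn : Module.finrank F E = n)
    {N : MvPolynomial (Fin n) F}
    (hN : MvPolynomial.map (algebraMap F E) N = ∏ σ : E ≃ₐ[F] E, powerForm n (σ a)) :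
    Irreducible N := by
  have hpos : 0 < n := hn ▸ Module.finrank_pos
  have hirr (β : E) := irreducible_powerForm hpos β
  have hdvd : powerForm n a ∣ MvPolynomial.map (algebraMap F E) N := by
    have := Finset.dvd_prod_of_mem (fun σ : E ≃ₐ[F] E ↦ powerForm n (σ a))
      (Finset.mem_univ AlgEquiv.refl)
    rwa [← hN, AlgEquiv.coe_refl, id] at this
  have hN0 : MvPolynomial.map (algebraMap F E) N ≠ 0 := by
    rw [hN]
    exact Finset.prod_ne_zero_iff.2 fun σ _ ↦ (hirr _).ne_zero
  have key (A B : MvPolynomial (Fin n) F) (hAB : N = A * B)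
      (hA : powerForm n a ∣ MvPolynomial.map (algebraMap F E) A) : IsUnit B := by
    have hNA : MvPolynomial.map (algebraMap F E) N ∣ MvPolynomial.map (algebraMap F E) A := by
      rw [hN]
      refine Finset.prod_dvd_of_isRelPrime (fun σ _ τ _ hστ ↦ ?_) fun σ _ ↦ ?_
      · refine (hirr _).isRelPrime_iff_not_dvd.2 fun hd ↦
          hστ (injective_algEquiv_apply h (eq_of_powerForm_dvd ?_ hd))
        have : Nontrivial (E ≃ₐ[F] E) := ⟨σ, τ, hστ⟩
        exact hn ▸ Fintype.one_lt_card.trans_le AlgEquiv.card_le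
      · have hσ : (σ : E →+* E).comp (algebraMap F E) = algebraMap F E :=
          RingHom.ext σ.commutes
        have := map_dvd (MvPolynomial.map (σ : E →+* E)) hA
        rwa [map_powerForm, MvPolynomial.map_map, hσ] at this
    refine MvPolynomial.isUnit_of_isUnit_map (algebraMap F E) ?_
    obtain ⟨C, hC⟩ := hNA
    have hmul := congrArg (MvPolynomial.map (algebraMap F E)) hAB
    rw [map_mul, hC, mul_assoc] at hmul
    exact IsUnit.of_mul_eq_one_right C (mul_left_cancel₀ hN0 (by rw [← hmul, mul_one]))
  refine ⟨fun hu ↦ (hirr a).not_isUnit (isUnit_of_dvd_unit hdvd (hu.map _)), fun A B hAB ↦ ?_⟩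
  rw [hAB, map_mul] at hdvd
  exact ((hirr a).prime.dvd_or_dvd hdvd).symm.imp
    (key B A (hAB.trans (mul_comm _ _))) (key A B hAB)

theorem isGalois_of_map_minpoly {k Ω : Type*} [Field k] [Field Ω] [Algebra k Ω]
    {K : IntermediateField k Ω} [IsGalois k K] (a : K) {L : IntermediateField k Ω}
    {M : IntermediateField L Ω} (hKM : ∀ x ∈ K, x ∈ M) (hM : M = L⟮(a : Ω)⟯) :
    IsGalois L M := by
  let j : K →+* M := (algebraMap K Ω).codRestrict M fun x ↦ hKM x x.2
  let p := (minpoly k a).map (algebraMap k L)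
  have hp : p.map (algebraMap L M) = ((minpoly k a).map (algebraMap k K)).map j := by
    rw [Polynomial.map_map, Polynomial.map_map]
    congr 1
  have : p.IsSplittingField L M := by
    refine isSplittingField_iff_intermediateField.2 ⟨?_, ?_⟩
    · rw [hp]
      exact (IsGalois.splits k a).map j
    · have ha : (⟨a, hKM a a.2⟩ : M) ∈ p.rootSet M := by
        refine mem_rootSet'.2 ⟨(((minpoly.monic (IsGalois.integral k a)).map _).map _).ne_zero, ?_⟩
        rw [← eval_map_algebraMap, hp]
        have : (⟨a, hKM a a.2⟩ : M) = j a := rfl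
        rw [this, eval_map_apply, eval_map_algebraMap, minpoly.aeval, map_zero]
      rw [eq_top_iff, ← adjoin_simple_coe_eq_top (a := (⟨a, hKM a a.2⟩ : M)) hM]
      exact adjoin.mono _ _ _ (Set.singleton_subset_iff.2 ha)
  exact .of_separable_splitting_field (p := p) (Separable.map (IsGalois.separable k a))

/-- Let `k` be a perfect field, `K/k` a finite Galois extension of degree `n`
with `K = k(α)` (minimal polynomial `f_K` of degree `n`), inside a field extension `Ω` of `k`,
and let `L` be an intermediate field of `Ω/k` such that `f_K` remains irreducible in `L[x]`.
Then the norm form `N_{K/k,α}` (a polynomial `N₀` with coefficients in `k`) remains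
irreducible as an element of `L[x₀,…,x_{n−1}]`, and it coincides with the norm form
`N_{LK/L,α}` of the compositum extension `LK/L`. -/
theorem stmt6 (k Ω : Type*) [Field k] [PerfectField k] [Field Ω] [Algebra k Ω]
    (K : IntermediateField k Ω) [FiniteDimensional k K] [IsGalois k K]
    (n : ℕ) (hdeg : Module.finrank k K = n)
    (α : Ω) (hαK : α ∈ K) (hK : K = IntermediateField.adjoin k {α})
    (hfK : (minpoly k α).natDegree = n)
    (L : IntermediateField k Ω)
    (hirrL : Irreducible ((minpoly k α).map (algebraMap k L)))
    (LK : IntermediateField L Ω) [FiniteDimensional L LK]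
    (hLK : LK = IntermediateField.adjoin L (K : Set Ω))
    (hαLK : α ∈ LK) :
    ∀ N₀ : MvPolynomial (Fin n) k,
      MvPolynomial.map (algebraMap k K) N₀ =
          (∏ σ : K ≃ₐ[k] K, ∑ i : Fin n,
            MvPolynomial.C ((σ (⟨α, hαK⟩ : K)) ^ (i : ℕ)) * MvPolynomial.X i) →
        Irreducible (MvPolynomial.map (algebraMap k L) N₀) ∧
          MvPolynomial.map (algebraMap k Ω) N₀ =
            ∏ σ : LK ≃ₐ[L] LK, ∑ i : Fin n,
              MvPolynomial.C (((σ (⟨α, hαLK⟩ : LK)) : Ω) ^ (i : ℕ)) * MvPolynomial.X i := by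
  intro N₀ hN₀
  have hM : LK = L⟮α⟯ := by
    rw [hLK]
    apply le_antisymm
    · rw [adjoin_le_iff]
      have : K ≤ L⟮α⟯.restrictScalars k := by
        rw [hK, adjoin_simple_le_iff]
        exact mem_adjoin_simple_self L α
      exact this
    · exact adjoin.mono _ _ _ (Set.singleton_subset_iff.2 hαK)
  have hKM : ∀ x ∈ K, x ∈ LK := fun x hx ↦ hLK ▸ subset_adjoin L _ hx
  have : IsGalois L LK := isGalois_of_map_minpoly ⟨α, hαK⟩ hKM hM
  have hα : IsIntegral k α := (IsGalois.integral k (⟨α, hαK⟩ : K)).map K.val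
  have hmin : (minpoly k α).map (algebraMap k L) = minpoly L α :=
    minpoly.eq_of_irreducible_of_monic hirrL (by simp) ((minpoly.monic hα).map _)
  have hprod : MvPolynomial.map (algebraMap k Ω) N₀ =
      ∏ σ : LK ≃ₐ[L] LK, powerForm n ((σ ⟨α, hαLK⟩ : LK) : Ω) := by
    have hk := aroots_minpoly_eq_map_algEquiv_coe (a := (⟨α, hαK⟩ : K)) hK
    have hL := aroots_minpoly_eq_map_algEquiv_coe (a := (⟨α, hαLK⟩ : LK)) hM
    have hroots : (minpoly k α).aroots Ω = (minpoly L α).aroots Ω := by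
      rw [← hmin, aroots_def, aroots_def, Polynomial.map_map,
        ← IsScalarTower.algebraMap_eq]
    have hkL := congrArg (fun s ↦ (s.map (powerForm n)).prod) (hk.symm.trans (hroots.trans hL))
    simp only [Multiset.map_map] at hkL
    rw [IsScalarTower.algebraMap_eq k K Ω, ← MvPolynomial.map_map, hN₀, map_prod]
    refine Eq.trans (Finset.prod_congr rfl fun σ _ ↦ ?_) hkL
    exact map_powerForm (algebraMap K Ω) n _
  refine ⟨irreducible_of_map_eq_prod_powerForm (E := LK)
    (adjoin_simple_coe_eq_top (a := (⟨α, hαLK⟩ : LK)) hM) ?_ ?_, hprod⟩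
  · rw [hM, adjoin.finrank hα.tower_top, ← hmin, natDegree_map, hfK]
  · apply MvPolynomial.map_injective (algebraMap LK Ω) (algebraMap LK Ω).injective
    rw [MvPolynomial.map_map, MvPolynomial.map_map, map_prod]
    refine Eq.trans ?_ (hprod.trans (Finset.prod_congr rfl fun σ _ ↦ ?_))
    · rfl
    · exact (map_powerForm (algebraMap LK Ω) n _).symm
end

section
/- Let k be a perfect field, K/k a finite Galois extension of degree n with K = k(α), where α has minimal polynomial f_K ∈ k[x] of degree n, let Ω be a field extension of k containing K, and let L be an intermediate field of Ω/k. Then every monic irreducible factor of the norm form N_{K/k,α} in L[x₀,…,x_{n−1}] is of the form ∏_{σ ∈ Gal(LK/L)} σσ₀(x₀ + α·x₁ + ⋯ + α^{n−1}·x_{n−1}) for some σ₀ ∈ Gal(K/k); in particular, N_{K/k,α} splits in L[x₀,…,x_{n−1}] into irreducible factors all having the same total degree [LK : L]. -/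
open Polynomial IntermediateField

namespace NormForm

/-- The linear form `x₀ + β x₁ + ⋯ + β ^ (n - 1) x_{n - 1}`. -/
noncomputable def linForm {E : Type*} [CommSemiring E] (n : ℕ) (β : E) : MvPolynomial (Fin n) E :=
  ∑ i : Fin n, MvPolynomial.C (β ^ (i : ℕ)) * MvPolynomial.X i

theorem map_linForm {E F : Type*} [CommSemiring E] [CommSemiring F] (n : ℕ) (f : E →+* F) (β : E) :
    MvPolynomial.map f (linForm n β) = linForm n (f β) := by
  simp [linForm]

theorem coeff_linForm {E : Type*} [CommSemiring E] {n : ℕ} (β : E) (j : Fin n) :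
    MvPolynomial.coeff (Finsupp.single j 1) (linForm n β) = β ^ (j : ℕ) := by
  classical
  rw [linForm, MvPolynomial.coeff_sum, Finset.sum_eq_single j]
  · rw [MvPolynomial.coeff_C_mul, MvPolynomial.coeff_X, if_pos rfl, mul_one]
  · intro i _ hij
    rw [MvPolynomial.coeff_C_mul, MvPolynomial.coeff_X, if_neg, mul_zero]
    rwa [Finsupp.single_left_inj one_ne_zero]
  · simp

theorem isHomogeneous_linForm {E : Type*} [CommSemiring E] (n : ℕ) (β : E) :
    (linForm n β).IsHomogeneous 1 :=
  MvPolynomial.IsHomogeneous.sum _ _ _ fun _ _ ↦ MvPolynomial.isHomogeneous_C_mul_X _ _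

section Field

variable {E : Type*} [Field E] {n : ℕ}

theorem linForm_ne_zero (hn : 0 < n) (β : E) : linForm n β ≠ 0 := by
  intro h
  have := coeff_linForm β (⟨0, hn⟩ : Fin n)
  simp [h] at this

theorem irreducible_linForm (hn : 0 < n) (β : E) : Irreducible (linForm n β) := by
  refine MvPolynomial.irreducible_of_totalDegree_eq_one
    ((isHomogeneous_linForm n β).totalDegree (linForm_ne_zero hn β)) fun x hx ↦ ?_
  have := hx (Finsupp.single ⟨0, hn⟩ 1)
  rw [coeff_linForm] at this
  exact isUnit_of_dvd_one (by simpa using this)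

theorem eq_of_linForm_dvd (hn : 0 < n) {β γ : E} (h : linForm n β ∣ linForm n γ) :
    linForm n β = linForm n γ := by
  obtain ⟨u, hu⟩ := (irreducible_linForm hn β).associated_of_dvd (irreducible_linForm hn γ) h
  obtain ⟨r, -, hr⟩ := MvPolynomial.isUnit_iff_eq_C_of_isReduced.mp u.isUnit
  rw [hr, mul_comm] at hu
  have := congrArg (MvPolynomial.coeff (Finsupp.single ⟨0, hn⟩ 1)) hu
  rw [MvPolynomial.coeff_C_mul, coeff_linForm, coeff_linForm] at this
  have hr1 : r = 1 := by simpa using this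
  simpa [hr1] using hu

theorem isHomogeneous_prod_linForm {ι : Type*} [Fintype ι] (b : ι → E) :
    (∏ i, linForm n (b i)).IsHomogeneous (Fintype.card ι) := by
  simpa using MvPolynomial.IsHomogeneous.prod Finset.univ (fun i ↦ linForm n (b i)) (fun _ ↦ 1)
    fun i _ ↦ isHomogeneous_linForm n (b i)

theorem eval_single_one_of_isHomogeneous {R σ : Type*} [CommSemiring R] [DecidableEq σ] {d : ℕ}
    {p : MvPolynomial σ R} (hp : p.IsHomogeneous d) (j : σ) :
    MvPolynomial.eval (Pi.single j 1) p = MvPolynomial.coeff (Finsupp.single j d) p := by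
  rw [MvPolynomial.eval_eq, Finset.sum_eq_single (Finsupp.single j d)]
  · rw [Finset.prod_eq_one, mul_one]
    intro i hi
    obtain rfl : i = j := by
      have := Finsupp.support_single_subset hi
      simpa using this
    simp
  · intro m hm hmj
    suffices ∃ i ∈ m.support, i ≠ j by
      obtain ⟨i, hi, hij⟩ := this
      rw [Finset.prod_eq_zero hi, mul_zero]
      rw [Pi.single_eq_of_ne hij, zero_pow (Finsupp.mem_support_iff.mp hi)]
    by_contra! h
    have hms : m = Finsupp.single j (m j) :=
      Finsupp.support_subset_singleton.mp fun i hi ↦ Finset.mem_singleton.mpr (h i hi)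
    have hd : m.degree = d := by
      by_contra hd
      exact MvPolynomial.mem_support_iff.mp hm (hp.coeff_eq_zero hd)
    rw [hms, Finsupp.degree_single] at hd
    exact hmj (hd ▸ hms)
  · intro h
    rw [MvPolynomial.notMem_support_iff.mp h, zero_mul]

theorem coeff_prod_linForm (hn : 0 < n) {ι : Type*} [Fintype ι] (b : ι → E) :
    MvPolynomial.coeff (Finsupp.single (⟨0, hn⟩ : Fin n) (Fintype.card ι))
      (∏ i, linForm n (b i)) = 1 := by
  classical
  rw [← eval_single_one_of_isHomogeneous (isHomogeneous_prod_linForm b), map_prod]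
  refine Finset.prod_eq_one fun i _ ↦ ?_
  rw [eval_single_one_of_isHomogeneous (isHomogeneous_linForm n (b i)), coeff_linForm]
  simp

end Field

section Galois

variable {L E σ : Type*} [Field L] [Field E] [Algebra L E]

theorem mem_range_map_iff_fixed [FiniteDimensional L E] [IsGalois L E] (p : MvPolynomial σ E) :
    p ∈ Set.range (MvPolynomial.map (σ := σ) (algebraMap L E)) ↔
      ∀ τ : E ≃ₐ[L] E, MvPolynomial.map (τ : E →+* E) p = p := by
  constructor
  · rintro ⟨q, rfl⟩ τ
    have hτ : (τ : E →+* E).comp (algebraMap L E) = algebraMap L E := RingHom.ext τ.commutes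
    rw [MvPolynomial.map_map, hτ]
  · intro h
    rw [MvPolynomial.mem_range_map_iff_coeffs_subset]
    intro c hc
    obtain ⟨m, -, rfl⟩ := MvPolynomial.mem_coeffs_iff.mp hc
    refine (IsGalois.mem_range_algebraMap_iff_fixed _).mpr fun τ ↦ ?_
    have := congrArg (MvPolynomial.coeff m) (h τ)
    rwa [MvPolynomial.coeff_map] at this

theorem isUnit_of_isUnit_map {p : MvPolynomial σ L}
    (h : IsUnit (MvPolynomial.map (algebraMap L E) p)) : IsUnit p := by
  obtain ⟨r, hr, hp⟩ := MvPolynomial.isUnit_iff_eq_C_of_isReduced.mp h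
  have h0 : r = algebraMap L E (p.coeff 0) := by
    rw [← MvPolynomial.coeff_map, hp, MvPolynomial.coeff_zero_C]
  refine MvPolynomial.isUnit_iff_eq_C_of_isReduced.mpr ⟨p.coeff 0, ?_, ?_⟩
  · rw [isUnit_iff_ne_zero]
    intro hz
    rw [h0, hz, map_zero] at hr
    exact not_isUnit_zero hr
  · apply MvPolynomial.map_injective _ (algebraMap L E).injective
    rw [MvPolynomial.map_C, hp, h0]

theorem exists_map_eq_C_mul_prod_linForm [FiniteDimensional L E] [IsGalois L E] {n : ℕ}
    (hn : 0 < n) (β : E) (hinj : Function.Injective fun τ : E ≃ₐ[L] E ↦ linForm n (τ β))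
    {g : MvPolynomial (Fin n) L} (hg : Irreducible g)
    (hdvd : linForm n β ∣ MvPolynomial.map (algebraMap L E) g) :
    ∃ c : L, c ≠ 0 ∧ MvPolynomial.map (algebraMap L E) g =
      MvPolynomial.C (algebraMap L E c) * ∏ τ : E ≃ₐ[L] E, linForm n (τ β) := by
  set G := MvPolynomial.map (algebraMap L E) g with hG
  set P := ∏ τ : E ≃ₐ[L] E, linForm n (τ β) with hP
  have hGfix := (mem_range_map_iff_fixed (L := L) G).mp ⟨g, rfl⟩
  have hPfix : ∀ τ : E ≃ₐ[L] E, MvPolynomial.map (τ : E →+* E) P = P := by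
    intro τ
    rw [hP, map_prod]
    refine Fintype.prod_equiv (Equiv.mulLeft τ) _ _ fun ρ ↦ ?_
    rw [map_linForm]
    rfl
  have hP0 : P ≠ 0 := Finset.prod_ne_zero_iff.mpr fun τ _ ↦ linForm_ne_zero hn _
  have hPG : P ∣ G := by
    refine Fintype.prod_dvd_of_isRelPrime (fun τ ρ hne ↦ ?_) fun τ ↦ ?_
    · rw [Function.onFun, (irreducible_linForm hn _).isRelPrime_iff_not_dvd]
      exact fun h ↦ hne (hinj (eq_of_linForm_dvd hn h))
    · have := map_dvd (MvPolynomial.map (σ := Fin n) (τ : E →+* E)) hdvd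
      rwa [hGfix, map_linForm] at this
  obtain ⟨Q, hQ⟩ := hPG
  obtain ⟨p, hp⟩ := (mem_range_map_iff_fixed (L := L) P).mpr hPfix
  obtain ⟨q, hq⟩ := (mem_range_map_iff_fixed (L := L) Q).mpr fun τ ↦ by
    apply mul_left_cancel₀ hP0
    conv_lhs => rw [← hPfix τ]
    rw [← map_mul, ← hQ, hGfix]
  have hgpq : g = p * q := by
    apply MvPolynomial.map_injective _ (algebraMap L E).injective
    rw [map_mul, hp, hq, ← hQ]
  have hpu : ¬ IsUnit p := by
    intro hu
    have : IsUnit P := hp ▸ hu.map _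
    have h1 : linForm n ((1 : E ≃ₐ[L] E) β) ∣ P :=
      Finset.dvd_prod_of_mem _ (Finset.mem_univ _)
    exact (irreducible_linForm hn _).not_isUnit (isUnit_of_dvd_unit h1 this)
  obtain ⟨c, hc, rfl⟩ := MvPolynomial.isUnit_iff_eq_C_of_isReduced.mp
    ((hg.isUnit_or_isUnit hgpq).resolve_left hpu)
  refine ⟨c, hc.ne_zero, ?_⟩
  rw [hQ, ← hq, MvPolynomial.map_C, mul_comm]

theorem totalDegree_map_algebraMap (p : MvPolynomial σ L) :
    (MvPolynomial.map (algebraMap L E) p).totalDegree = p.totalDegree := by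
  simp only [MvPolynomial.totalDegree,
    MvPolynomial.support_map_of_injective p (algebraMap L E).injective]

theorem exists_linForm_dvd {n : ℕ} (hn : 0 < n) {ι : Type*} [Fintype ι] (b : ι → E)
    {G : MvPolynomial (Fin n) E} (hG : ¬ IsUnit G) (hdvd : G ∣ ∏ i, linForm n (b i)) :
    ∃ i, linForm n (b i) ∣ G := by
  have hG0 : G ≠ 0 := ne_zero_of_dvd_ne_zero
    (Finset.prod_ne_zero_iff.mpr fun i _ ↦ linForm_ne_zero hn (b i)) hdvd
  obtain ⟨q, hq, hqG⟩ := WfDvdMonoid.exists_irreducible_factor hG hG0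
  obtain ⟨i, -, hi⟩ := hq.prime.exists_mem_finset_dvd (hqG.trans hdvd)
  exact ⟨i, ((hq.associated_of_dvd (irreducible_linForm hn _) hi).symm.dvd).trans hqG⟩

end Galois

section Compositum

variable {k Ω : Type*} [Field k] [Field Ω] [Algebra k Ω] (K : IntermediateField k Ω)
  (L : IntermediateField k Ω) (LK : IntermediateField L Ω)

theorem isGalois_of_eq_adjoin [FiniteDimensional k K] [IsGalois k K]
    (hLK : LK = IntermediateField.adjoin L (K : Set Ω)) : IsGalois L LK := by
  obtain ⟨T, hT₁, hT₂⟩ := IsGalois.is_separable_splitting_field k K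
  have hT := IntermediateField.isSplittingField_iff.mp hT₂
  suffices (T.map (algebraMap k L)).IsSplittingField L LK from
    IsGalois.of_separable_splitting_field (p := T.map (algebraMap k L)) hT₁.map
  have hroot : (T.map (algebraMap k L)).rootSet Ω = T.rootSet Ω := by
    simp [Set.ext_iff, Polynomial.mem_rootSet']
  have hK : (K : Set Ω) ⊆ LK := by rw [hLK]; exact IntermediateField.subset_adjoin _ _
  have hle : K ≤ LK.restrictScalars k := hK
  rw [IntermediateField.isSplittingField_iff]
  constructor
  · rw [Polynomial.map_map]
    exact Polynomial.Splits.of_algHom hT.1 (IntermediateField.inclusion hle)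
  · rw [hroot, hLK]
    apply le_antisymm
    · rw [IntermediateField.adjoin_le_iff]
      have h : K ≤ (IntermediateField.adjoin L (T.rootSet Ω)).restrictScalars k := by
        conv_lhs => rw [hT.2]
        rw [IntermediateField.adjoin_le_iff]
        exact IntermediateField.subset_adjoin L (T.rootSet Ω)
      exact h
    · apply IntermediateField.adjoin.mono
      have := IntermediateField.subset_adjoin k (T.rootSet Ω)
      rwa [← hT.2] at this

theorem algEquiv_ext_of_eq_adjoin (hLK : LK = IntermediateField.adjoin L (K : Set Ω))
    {τ ρ : LK ≃ₐ[L] LK} (h : ∀ x : LK, (x : Ω) ∈ K → τ x = ρ x) : τ = ρ := by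
  have : (τ : LK →ₐ[L] LK) = (ρ : LK →ₐ[L] LK) :=
    IntermediateField.algHom_ext_of_eq_adjoin _ hLK fun x hx ↦ h ⟨x, _⟩ hx
  ext x
  exact congrArg Subtype.val (DFunLike.congr_fun this x)

end Compositum

end NormForm

/-- Let `k` be a perfect field, `K/k` a finite Galois extension of degree `n`
with `K = k(α)` (minimal polynomial `f_K` of degree `n`), inside a field extension `Ω` of `k`,
and let `L` be an intermediate field of `Ω/k`. Then every monic irreducible factor of the norm
form `N_{K/k,α}` (a polynomial `N₀` with coefficients in `k`) in `L[x₀,…,x_{n−1}]` is of the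
form `∏_{σ ∈ Gal(LK/L)} σσ₀(x₀ + αx₁ + ⋯ + α^{n−1}x_{n−1})` for some `σ₀ ∈ Gal(K/k)`; in
particular all irreducible factors have the same total degree `[LK : L]`.  (Here "monic" means
that the coefficient of `x₀^{totalDegree}` is `1`.) -/
theorem stmt7 (k Ω : Type*) [Field k] [PerfectField k] [Field Ω] [Algebra k Ω]
    (K : IntermediateField k Ω) [FiniteDimensional k K] [IsGalois k K]
    (n : ℕ) (hn0 : 0 < n) (hdeg : Module.finrank k K = n)
    (α : Ω) (hαK : α ∈ K) (hK : K = IntermediateField.adjoin k {α})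
    (hfK : (minpoly k α).natDegree = n)
    (L : IntermediateField k Ω)
    (LK : IntermediateField L Ω) [FiniteDimensional L LK]
    (hLK : LK = IntermediateField.adjoin L (K : Set Ω))
    (hKLK : ∀ x : K, (x : Ω) ∈ LK) :
    ∀ N₀ : MvPolynomial (Fin n) k,
      MvPolynomial.map (algebraMap k K) N₀ =
          (∏ σ : K ≃ₐ[k] K, ∑ i : Fin n,
            MvPolynomial.C ((σ (⟨α, hαK⟩ : K)) ^ (i : ℕ)) * MvPolynomial.X i) →
        ∀ g : MvPolynomial (Fin n) L, Irreducible g →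
          g ∣ MvPolynomial.map (algebraMap k L) N₀ →
            g.totalDegree = Module.finrank L LK ∧
              (MvPolynomial.coeff (Finsupp.single (⟨0, hn0⟩ : Fin n) g.totalDegree) g = 1 →
                ∃ σ₀ : K ≃ₐ[k] K,
                  MvPolynomial.map (algebraMap L Ω) g =
                    ∏ σ : LK ≃ₐ[L] LK, ∑ i : Fin n,
                      MvPolynomial.C
                        (((σ ⟨(σ₀ (⟨α, hαK⟩ : K) : Ω), hKLK _⟩ : LK) : Ω) ^ (i : ℕ)) *
                        MvPolynomial.X i) := by
  classical
  intro N₀ hN₀ g hg hgN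
  have hGal := NormForm.isGalois_of_eq_adjoin K L LK hLK
  let ι : K →+* LK := (algebraMap K Ω).codRestrict LK hKLK
  have hιL : (algebraMap L LK).comp (algebraMap k L) = ι.comp (algebraMap k K) := rfl
  let a : K := ⟨α, hαK⟩
  have hN : MvPolynomial.map (algebraMap L LK) (MvPolynomial.map (algebraMap k L) N₀) =
      ∏ σ : K ≃ₐ[k] K, NormForm.linForm n (ι (σ a)) := by
    rw [MvPolynomial.map_map, hιL, ← MvPolynomial.map_map, hN₀, map_prod]
    exact Finset.prod_congr rfl fun σ _ ↦ NormForm.map_linForm n ι (σ a)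
  have hdvd := map_dvd (MvPolynomial.map (σ := Fin n) (algebraMap L LK)) hgN
  rw [hN] at hdvd
  obtain ⟨σ₀, hσ₀⟩ := NormForm.exists_linForm_dvd hn0 (fun σ : K ≃ₐ[k] K ↦ ι (σ a))
    (fun h ↦ hg.not_isUnit (NormForm.isUnit_of_isUnit_map h)) hdvd
  have hinj : Function.Injective fun τ : LK ≃ₐ[L] LK ↦
      NormForm.linForm n (τ (ι (σ₀ a))) := by
    intro τ ρ h
    have hβ : τ (ι (σ₀ a)) = ρ (ι (σ₀ a)) := by
      rcases Nat.lt_or_ge 1 n with h1 | h1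
      · have := congrArg (MvPolynomial.coeff (Finsupp.single ⟨1, h1⟩ 1)) h
        simpa only [NormForm.coeff_linForm, pow_one] using this
      · have hb : Module.finrank k K = 1 := by omega
        obtain ⟨c, hc⟩ : ∃ c : k, algebraMap k K c = σ₀ a := by
          have : σ₀ a ∈ (⊥ : Subalgebra k K) := by
            rw [Subalgebra.bot_eq_top_of_finrank_eq_one hb]; trivial
          exact Algebra.mem_bot.mp this
        have hcL : ι (σ₀ a) = algebraMap L LK (algebraMap k L c) := by rw [← hc]; rfl
        rw [hcL, AlgEquiv.commutes, AlgEquiv.commutes]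
    let f (τ : LK ≃ₐ[L] LK) : K →ₐ[k] Ω :=
      { toRingHom := (algebraMap LK Ω).comp ((τ : LK →+* LK).comp (ι.comp (σ₀ : K →+* K)))
        commutes' := fun c ↦ by
          have h1 : ι (σ₀ (algebraMap k K c)) = algebraMap L LK (algebraMap k L c) := by
            rw [AlgEquiv.commutes]; rfl
          change algebraMap LK Ω (τ (ι (σ₀ (algebraMap k K c)))) = _
          rw [h1, AlgEquiv.commutes]
          rfl }
    have hf : f τ = f ρ := IntermediateField.algHom_ext_of_eq_adjoin _ hK fun x hx ↦ by
      obtain rfl : x = α := hx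
      exact congrArg (algebraMap LK Ω) hβ
    refine NormForm.algEquiv_ext_of_eq_adjoin K L LK hLK fun x hx ↦ ?_
    have := DFunLike.congr_fun hf (σ₀.symm ⟨x, hx⟩)
    change ((τ (ι (σ₀ (σ₀.symm ⟨x, hx⟩))) : LK) : Ω) = (ρ (ι (σ₀ (σ₀.symm ⟨x, hx⟩))) : LK) at this
    rw [AlgEquiv.apply_symm_apply] at this
    exact Subtype.ext this
  obtain ⟨c, hc, hgc⟩ := NormForm.exists_map_eq_C_mul_prod_linForm hn0 _ hinj hg hσ₀
  have hcard : Fintype.card (LK ≃ₐ[L] LK) = Module.finrank L LK := by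
    rw [← Nat.card_eq_fintype_card, IsGalois.card_aut_eq_finrank]
  have hdeg' : g.totalDegree = Fintype.card (LK ≃ₐ[L] LK) := by
    rw [← NormForm.totalDegree_map_algebraMap (E := LK) g]
    refine MvPolynomial.IsHomogeneous.totalDegree ?_ ?_
    · rw [hgc]
      exact (NormForm.isHomogeneous_prod_linForm _).C_mul _
    · exact (map_ne_zero_iff _
        (MvPolynomial.map_injective _ (algebraMap L LK).injective)).mpr hg.ne_zero
  refine ⟨hdeg'.trans hcard, fun hmonic ↦ ⟨σ₀, ?_⟩⟩
  have hc1 : algebraMap L LK c = 1 := by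
    have := congrArg (MvPolynomial.coeff (Finsupp.single (⟨0, hn0⟩ : Fin n) g.totalDegree)) hgc
    rw [MvPolynomial.coeff_map, hmonic, map_one, MvPolynomial.coeff_C_mul, hdeg',
      NormForm.coeff_prod_linForm, mul_one] at this
    exact this.symm
  rw [hc1, map_one, one_mul] at hgc
  rw [IsScalarTower.algebraMap_eq L LK Ω, ← MvPolynomial.map_map, hgc, map_prod]
  exact Finset.prod_congr rfl fun τ _ ↦ NormForm.map_linForm n (algebraMap LK Ω) _
end

section
/- Let n ≥ 2 be an integer and k a number field containing a primitive n-th root of unity. Let a ∈ k× be such that xⁿ − a is irreducible over k, let K = k[x]/(xⁿ − a), and fix an n-th root ⁿ√a of a in K. Let r₀, …, r_m be positive integers each dividing n. Then there exist pairwise distinct elements u₀, …, u_m ∈ k such that for each i the polynomial x^{r_i} − u_i − (ⁿ√a)^{r_i} is irreducible over K. -/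
open Polynomial
open scoped NumberField

/-- If `K` contains a primitive `r`-th root of unity and `c` is not a `p`-th power for any prime
`p ∣ r`, then `X ^ r - c` is irreducible over `K`. -/
theorem X_pow_sub_C_irreducible_of_isPrimitiveRoot {K : Type*} [Field K] {r : ℕ} (hr : 0 < r)
    {ζ : K} (hζ : IsPrimitiveRoot ζ r) {c : K}
    (hc : ∀ p : ℕ, p.Prime → p ∣ r → ∀ z : K, z ^ p ≠ c) :
    Irreducible (X ^ r - C c : K[X]) := by
  rcases eq_or_ne r 1 with rfl | hr1
  · simpa using irreducible_X_sub_C c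
  have hc0 : c ≠ 0 := by
    obtain ⟨p, hp, hpr⟩ := Nat.exists_prime_and_dvd hr1
    rintro rfl
    exact hc p hp hpr 0 (zero_pow hp.ne_zero)
  have hnu : ¬ IsUnit (X ^ r - C c : K[X]) := by
    rw [Polynomial.isUnit_iff_degree_eq_zero, degree_X_pow_sub_C hr, Nat.cast_eq_zero]
    exact hr.ne'
  obtain ⟨g, hg, hgd⟩ := WfDvdMonoid.exists_irreducible_factor hnu (X_pow_sub_C_ne_zero hr c)
  have := Fact.mk hg
  set d := g.natDegree with hd
  have hfin : Module.finrank K (AdjoinRoot g) = d := by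
    rw [(AdjoinRoot.powerBasis hg.ne_zero).finrank, AdjoinRoot.powerBasis_dim]
  have hroot : AdjoinRoot.root g ^ r = algebraMap K (AdjoinRoot g) c := by
    have h := aeval_eq_zero_of_dvd_aeval_eq_zero hgd
      (show aeval (AdjoinRoot.root g) g = 0 by simp [AdjoinRoot.aeval_eq])
    simpa [sub_eq_zero] using h
  have hnorm : (Algebra.norm K (AdjoinRoot.root g)) ^ r = c ^ d := by
    rw [← map_pow, hroot, Algebra.norm_algebraMap, hfin]
  set b := Algebra.norm K (AdjoinRoot.root g)
  have hb0 : b ≠ 0 := by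
    intro h
    rw [h, zero_pow hr.ne'] at hnorm
    exact pow_ne_zero d hc0 hnorm.symm
  set e := Nat.gcd d r
  have her : e ∣ r := Nat.gcd_dvd_right d r
  obtain ⟨t, ht⟩ := her
  have he0 : 0 < e := Nat.gcd_pos_of_pos_right d hr
  have : NeZero e := ⟨he0.ne'⟩
  obtain ⟨h, hh0, hh⟩ : ∃ h : K, h ≠ 0 ∧ c ^ e = h ^ r := by
    refine ⟨b ^ (d.gcdA r) * c ^ (d.gcdB r),
      mul_ne_zero (zpow_ne_zero _ hb0) (zpow_ne_zero _ hc0), ?_⟩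
    rw [mul_pow, ← zpow_natCast, ← zpow_natCast, ← zpow_natCast, Nat.gcd_eq_gcd_ab,
      zpow_add₀ hc0, zpow_mul c d, zpow_natCast c d, ← hnorm, ← zpow_natCast b r,
      ← zpow_mul, ← zpow_mul, ← zpow_mul, mul_comm (r : ℤ), mul_comm (r : ℤ)]
  have hη : (c / h ^ t) ^ e = 1 := by
    rw [div_pow, hh, ← pow_mul, mul_comm t, ← ht, div_self (pow_ne_zero _ hh0)]
  have ht0 : t ≠ 0 := by rintro rfl; omega
  have hζe : IsPrimitiveRoot (ζ ^ t) e := hζ.pow hr (by rw [ht, mul_comm])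
  obtain ⟨i, -, hi⟩ := hζe.eq_pow_of_pow_eq_one hη
  have hct : (ζ ^ i * h) ^ t = c := by
    rw [mul_pow, ← pow_mul, mul_comm i, pow_mul, hi, div_mul_cancel₀ _ (pow_ne_zero _ hh0)]
  have ht1 : t = 1 := by
    by_contra ht1
    obtain ⟨p, hp, s, hs⟩ := Nat.exists_prime_and_dvd ht1
    refine hc p hp (ht ▸ (Dvd.intro s hs.symm).mul_left e) ((ζ ^ i * h) ^ s) ?_
    rw [← pow_mul, mul_comm s, ← hs, hct]
  have hrd : r ≤ d := by
    rw [ht1, mul_one] at ht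
    exact Nat.le_of_dvd hg.natDegree_pos (ht ▸ Nat.gcd_dvd_left d r)
  refine (associated_of_dvd_of_natDegree_le hgd (X_pow_sub_C_ne_zero hr c) ?_).irreducible hg
  rwa [natDegree_X_pow_sub_C]

/-- A finite field containing a primitive `n`-th root of unity has an element that is not a `p`-th
power for any prime `p ∣ n`. -/
theorem IsPrimitiveRoot.exists_forall_prime_pow_ne {F : Type*} [Field F] [Finite F] {n : ℕ} [NeZero n]
    {ζ : F} (hζ : IsPrimitiveRoot ζ n) :
    ∃ g : F, ∀ p : ℕ, p.Prime → p ∣ n → ∀ z : F, z ^ p ≠ g := by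
  obtain ⟨g, hg⟩ := IsCyclic.exists_ofOrder_eq_natCard (α := Fˣ)
  refine ⟨g, fun p hp hpn z hz ↦ ?_⟩
  have hz0 : z ≠ 0 := by
    rintro rfl
    rw [zero_pow hp.ne_zero] at hz
    exact g.ne_zero hz.symm
  have hzg : Units.mk0 z hz0 ^ p = g := Units.ext (by simpa using hz)
  have hcard : p ∣ Nat.card Fˣ := by
    refine hpn.trans ?_
    have h := orderOf_dvd_natCard hζ.toRootsOfUnity.1
    rwa [← orderOf_units, IsPrimitiveRoot.val_toRootsOfUnity_coe, ← hζ.eq_orderOf] at h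
  obtain ⟨s, hs⟩ := hcard
  have hs0 : 0 < s := Nat.pos_of_ne_zero fun h ↦
    absurd (by rw [hs, h, mul_zero]) (Nat.card_pos (α := Fˣ)).ne.symm
  have h1 : g ^ s = 1 := by rw [← hzg, ← pow_mul, ← hs, pow_card_eq_one']
  have h2 := Nat.le_of_dvd hs0 (orderOf_dvd_of_pow_eq_one h1)
  rw [hg, hs] at h2
  nlinarith [hp.two_le]

/-- Some `ℤ[y]` contains a nonzero integer multiple of the ring of integers. -/
theorem NumberField.exists_aeval_eq_int_mul (K : Type*) [Field K] [NumberField K] :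
    ∃ (y : 𝓞 K) (N : ℤ), N ≠ 0 ∧ ∀ z : 𝓞 K, ∃ p : ℤ[X], aeval y p = (N : 𝓞 K) * z := by
  obtain ⟨α, hα⟩ := Field.exists_primitive_element ℚ K
  obtain ⟨c, hc, hint⟩ := ((IsFractionRing.isAlgebraic_iff ℤ ℚ K).2
    (Algebra.IsAlgebraic.isAlgebraic (R := ℚ) α)).exists_integral_multiple
  have hy : Algebra.adjoin ℚ {c • α} = ⊤ := by
    rw [← IntermediateField.adjoin_simple_toSubalgebra_of_isAlgebraic
      (Algebra.IsAlgebraic.isAlgebraic _), ← IntermediateField.top_toSubalgebra]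
    congr 1
    rw [eq_top_iff, ← hα, IntermediateField.adjoin_simple_le_iff]
    have h := (IntermediateField.adjoin ℚ {c • α}).smul_mem
      (IntermediateField.mem_adjoin_simple_self ℚ (c • α)) (x := (c : ℚ)⁻¹)
    rwa [← Int.cast_smul_eq_zsmul ℚ, smul_smul, inv_mul_cancel₀ (by exact_mod_cast hc),
      one_smul, Int.cast_smul_eq_zsmul] at h
  set B := PowerBasis.ofAdjoinEqTop hint.tower_top hy
  have hgen : B.gen = c • α := PowerBasis.ofAdjoinEqTop_gen _ _
  have hBint : IsIntegral ℤ B.gen := hgen ▸ hint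
  obtain ⟨N, hN⟩ := IsIntegrallyClosed.isIntegral_iff.1
    (Algebra.discr_isIntegral ℚ (R := ℤ) (b := B.basis)
      fun i ↦ by rw [B.basis_eq_pow]; exact hBint.pow _)
  obtain ⟨y, hyB⟩ : ∃ y : 𝓞 K, algebraMap (𝓞 K) K y = B.gen := ⟨⟨_, hBint⟩, rfl⟩
  refine ⟨y, N, ?_, fun z ↦ ?_⟩
  · rintro rfl
    exact Algebra.discr_not_zero_of_basis ℚ B.basis (by simpa using hN.symm)
  · have h := Algebra.discr_mul_isIntegral_mem_adjoin ℚ hBint z.isIntegral_coe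
    rw [Algebra.adjoin_singleton_eq_range_aeval] at h
    obtain ⟨p, hp⟩ := h
    refine ⟨p, RingOfIntegers.ext ?_⟩
    refine (aeval_algebraMap_apply K y p).symm.trans ?_
    rw [hyB]
    refine hp.trans ?_
    rw [← hN, Algebra.smul_def]
    simp

theorem NumberField.exists_not_isUnit_one_sub {K : Type*} [Field K] [NumberField K] {y : 𝓞 K}
    (hy : y ≠ 0) : ∃ s : ℕ, ¬ IsUnit (1 - s * y) := by
  have hσ (σ : K →ₐ[ℚ] ℂ) : ∀ᶠ s : ℕ in Filter.atTop, 2 < s * ‖σ y‖ := by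
    have h0 : 0 < ‖σ y‖ := by simpa using hy
    exact (tendsto_natCast_atTop_atTop.atTop_mul_const h0).eventually_gt_atTop 2
  obtain ⟨s, hs⟩ := (Filter.eventually_all.2 hσ).exists
  refine ⟨s, fun hu ↦ ?_⟩
  rw [isUnit_iff_norm, RingOfIntegers.coe_norm] at hu
  have h := congrArg norm (Algebra.norm_eq_prod_embeddings ℚ ℂ ((1 - s * y : 𝓞 K) : K))
  rw [eq_ratCast, Complex.norm_ratCast, ← Rat.cast_abs, hu, norm_prod, Rat.cast_one] at h
  have : Nonempty (K →ₐ[ℚ] ℂ) := ⟨IsAlgClosed.lift⟩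
  refine (Finset.prod_lt_prod_of_nonempty (s := Finset.univ) (fun _ _ ↦ one_pos)
    (fun σ _ ↦ ?_) Finset.univ_nonempty).ne (Finset.prod_const_one.trans h)
  have h1 : 2 < ‖(s : ℂ) * σ y‖ := by simpa using hs σ
  have h2 := norm_sub_norm_le ((s : ℂ) * σ y) 1
  rw [norm_sub_rev, norm_one] at h2
  simp only [map_sub, map_mul, map_one, map_natCast]
  linarith

/-- There is a maximal ideal of degree one over `ℚ` that does not contain `n`. -/
theorem NumberField.exists_isMaximal_surjective_intCast (K : Type*) [Field K] [NumberField K]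
    {n : ℕ} (hn : n ≠ 0) :
    ∃ P : Ideal (𝓞 K), P.IsMaximal ∧ (n : 𝓞 K) ∉ P ∧
      Function.Surjective (Int.castRingHom (𝓞 K ⧸ P)) := by
  obtain ⟨y, N, hN, hz⟩ := exists_aeval_eq_int_mul K
  obtain ⟨j, hj⟩ : ∃ j : ℤ, y + j ≠ 0 := by
    by_cases h : y = 0
    · exact ⟨1, by simp [h]⟩
    · exact ⟨0, by simpa using h⟩
  obtain ⟨s, hs⟩ := exists_not_isUnit_one_sub (y := (n : 𝓞 K) * (N : 𝓞 K) * (y + (j : 𝓞 K)))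
    (mul_ne_zero (mul_ne_zero (Nat.cast_ne_zero.2 hn) (Int.cast_ne_zero.2 hN)) hj)
  obtain ⟨P, hP, hwP⟩ := exists_max_ideal_of_mem_nonunits hs
  let _ := Ideal.Quotient.field P
  let _ := Fintype.ofFinite (𝓞 K ⧸ P)
  have hw : (1 : 𝓞 K ⧸ P) = s * (n * N * (Ideal.Quotient.mk P y + j)) := by
    rw [← sub_eq_zero]
    simpa using Ideal.Quotient.eq_zero_iff_mem.2 hwP
  have hinv (m : ℤ) : ∃ l : ℤ, (l : 𝓞 K ⧸ P) = (m : 𝓞 K ⧸ P)⁻¹ := by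
    by_cases hm : (m : 𝓞 K ⧸ P) = 0
    · exact ⟨0, by simp [hm]⟩
    refine ⟨m ^ (Fintype.card (𝓞 K ⧸ P) - 2), ?_⟩
    have hcard := Fintype.one_lt_card (α := 𝓞 K ⧸ P)
    refine eq_inv_of_mul_eq_one_left ?_
    rw [Int.cast_pow, ← pow_succ, ← FiniteField.pow_card_sub_one_eq_one _ hm]
    congr 1
    omega
  have hn' : (n : 𝓞 K ⧸ P) ≠ 0 := fun h ↦ by simp [h] at hw
  have hN' : (N : 𝓞 K ⧸ P) ≠ 0 := fun h ↦ by simp [h] at hw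
  refine ⟨P, hP, fun h ↦ hn' (by simpa using Ideal.Quotient.eq_zero_iff_mem.2 h), fun x ↦ ?_⟩
  obtain ⟨z, rfl⟩ := Ideal.Quotient.mk_surjective x
  obtain ⟨p, hp⟩ := hz z
  obtain ⟨l, hl⟩ := hinv (s * n * N)
  obtain ⟨N', hN'inv⟩ := hinv N
  have hy : Ideal.Quotient.mk P y = ((l - j : ℤ) : 𝓞 K ⧸ P) := by
    have : (l : 𝓞 K ⧸ P) = Ideal.Quotient.mk P y + j := by
      rw [hl]
      refine inv_eq_of_mul_eq_one_right ?_
      push_cast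
      linear_combination -hw
    push_cast
    rw [this, add_sub_cancel_right]
  have hpz := congrArg (Ideal.Quotient.mk P) hp
  rw [map_mul, map_intCast, aeval_def, hom_eval₂, hy,
    Subsingleton.elim ((Ideal.Quotient.mk P).comp (algebraMap ℤ (𝓞 K))) (Int.castRingHom _),
    eval₂_at_intCast, eq_intCast] at hpz
  refine ⟨N' * p.eval (l - j), ?_⟩
  rw [eq_intCast, Int.cast_mul, hN'inv, inv_mul_eq_iff_eq_mul₀ hN', ← hpz]
  simp

/-- Let `n ≥ 2` and let `k` be a number field containing a primitive `n`-th
root of unity. Let `a ∈ k×` with `xⁿ − a` irreducible over `k`, let `K = k[x]/(xⁿ − a)` and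
fix an `n`-th root `ⁿ√a` of `a` in `K`. Let `r₀, …, r_m` be positive integers dividing `n`.
Then there exist pairwise distinct `u₀, …, u_m ∈ k` such that for each `i` the polynomial
`x^{r_i} − u_i − (ⁿ√a)^{r_i}` is irreducible over `K`. -/
theorem stmt14 (n : ℕ) (hn : 2 ≤ n) (k : Type*) [Field k] [NumberField k]
    (ζ : k) (hζ : IsPrimitiveRoot ζ n)
    (a : k) (ha : a ≠ 0) (hairr : Irreducible (X ^ n - C a : Polynomial k))
    (K : Type*) [Field K] [Algebra k K]
    (ρ : K) (hρ : ρ ^ n = algebraMap k K a)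
    (hK : IntermediateField.adjoin k {ρ} = ⊤)
    (m : ℕ) (r : Fin (m + 1) → ℕ) (hrpos : ∀ i, 0 < r i) (hrdvd : ∀ i, r i ∣ n) :
    ∃ u : Fin (m + 1) → k, Function.Injective u ∧
      ∀ i, Irreducible
        (X ^ (r i) - C (algebraMap k K (u i)) - C (ρ ^ (r i)) : Polynomial K) := by
  have hn0 : n ≠ 0 := by omega
  have : NeZero n := ⟨hn0⟩
  have : CharZero K := charZero_of_injective_algebraMap (algebraMap k K).injective
  have : FiniteDimensional k K := by
    have hint : IsIntegral k ρ := IsIntegral.of_pow (by omega) (hρ ▸ isIntegral_algebraMap)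
    have := IntermediateField.adjoin.finiteDimensional hint
    rw [hK] at this
    exact IntermediateField.topEquiv.toLinearEquiv.finiteDimensional
  have : NumberField K := { to_finiteDimensional := FiniteDimensional.trans ℚ k K }
  have hζK : IsPrimitiveRoot (algebraMap k K ζ) n := hζ.map_of_injective (algebraMap k K).injective
  obtain ⟨P, hP, hnP, hsurj⟩ := NumberField.exists_isMaximal_surjective_intCast K hn0
  let _ := Ideal.Quotient.field P
  set φ := Ideal.Quotient.mk P
  have hζF : IsPrimitiveRoot (φ hζK.toInteger) n := by
    have : NeZero (n : 𝓞 K ⧸ P) :=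
      ⟨fun h ↦ hnP (Ideal.Quotient.eq_zero_iff_mem.1 (by rwa [map_natCast]))⟩
    rw [← isRoot_cyclotomic_iff, ← map_cyclotomic n φ]
    exact (hζK.toInteger_isPrimitiveRoot.isRoot_cyclotomic (by omega)).map
  obtain ⟨g, hg⟩ := hζF.exists_forall_prime_pow_ne
  obtain ⟨D, hD, hint⟩ := ((IsFractionRing.isAlgebraic_iff ℤ ℚ K).2
    (Algebra.IsAlgebraic.isAlgebraic (R := ℚ) ρ)).exists_integral_multiple
  obtain ⟨β, hβ⟩ : ∃ β : 𝓞 K, (β : K) = D * ρ := ⟨⟨_, hint⟩, zsmul_eq_mul _ _⟩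
  set q := Nat.card (𝓞 K ⧸ P)
  have hq : 0 < q := Nat.card_pos
  have hqF : (q : 𝓞 K ⧸ P) = 0 := by
    let _ := Fintype.ofFinite (𝓞 K ⧸ P)
    rw [← Nat.cast_card_eq_zero (𝓞 K ⧸ P), ← Nat.card_eq_fintype_card]
  choose w hw using fun i ↦ hsurj (g - φ (D ^ (n - r i) * β ^ r i))
  let v (i : Fin (m + 1)) : ℤ := w i % q + q * (i : ℕ)
  have hv_inj : Function.Injective v := by
    refine Function.Injective.of_comp (f := fun x : ℤ ↦ x / q) fun i j hij ↦ ?_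
    have hdiv (i) : v i / q = (i : ℕ) := by
      simp only [v]
      rw [Int.add_mul_ediv_left _ _ (by omega),
        Int.ediv_eq_zero_of_lt (Int.emod_nonneg _ (by omega)) (Int.emod_lt_of_pos _ (by omega)),
        zero_add]
    simp only [Function.comp_apply, hdiv] at hij
    exact Fin.ext (by exact_mod_cast hij)
  have hvF (i) : (v i : 𝓞 K ⧸ P) + φ (D ^ (n - r i) * β ^ r i) = g := by
    have : (v i : 𝓞 K ⧸ P) = w i := by
      simp [v, Int.emod_def, hqF]
    rw [this, ← eq_intCast (Int.castRingHom _), hw, sub_add_cancel]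
  have hDk : (D : k) ≠ 0 := by exact_mod_cast hD
  have hDK : (D : K) ≠ 0 := by exact_mod_cast hD
  refine ⟨fun i ↦ v i / D ^ n, fun i j hij ↦ hv_inj ?_, fun i ↦ ?_⟩
  · exact_mod_cast (div_left_inj' (pow_ne_zero n hDk)).1 hij
  rw [sub_sub, ← C_add]
  obtain ⟨t, ht⟩ := hrdvd i
  refine X_pow_sub_C_irreducible_of_isPrimitiveRoot (hrpos i)
    (hζK.pow (by omega) (ht.trans (mul_comm _ _))) fun p hp hpr z hz ↦ ?_
  obtain ⟨s, hs⟩ := hpr.trans (hrdvd i)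
  have hpow : (D ^ s * z) ^ p =
      algebraMap (𝓞 K) K ((v i : 𝓞 K) + D ^ (n - r i) * β ^ r i) := by
    have hsplit : (D : K) ^ n = D ^ (n - r i) * D ^ r i := by
      rw [← pow_add, Nat.sub_add_cancel (Nat.le_of_dvd (by omega) (hrdvd i))]
    rw [mul_pow, hz, ← pow_mul, mul_comm s, ← hs]
    simp only [map_add, map_mul, map_pow, map_intCast, map_div₀, hβ]
    rw [mul_add, mul_div_cancel₀ _ (pow_ne_zero n hDK), hsplit]
    ring
  obtain ⟨Z, hZ⟩ := IsIntegrallyClosed.exists_algebraMap_eq_of_isIntegral_pow (R := 𝓞 K) hp.pos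
    (hpow ▸ isIntegral_algebraMap)
  refine hg p hp (hpr.trans (hrdvd i)) (φ Z) ?_
  rw [← hvF i, ← map_pow, ← map_intCast φ, ← map_add]
  congr 1
  apply NumberField.RingOfIntegers.coe_injective
  rw [← hpow, ← hZ, map_pow]
end

section
/- Let n and m be fixed with m ≥ 0, and let F be a finite field. Let f₀, …, f_m ∈ F[x] be polynomials such that the product ∏_{i=0}^{m} f_i is a separable polynomial, and let r_i = deg(f_i) for each i. Assume each r_i is coprime to #F, and assume #F is large enough that #F + 1 − 2·(1 + ½·(∑_{i=0}^{m} r_i − m − 3))·(∏_{i=0}^{m} r_i)·√(#F) > (m + 2)·∏_{i=0}^{m} r_i. Then for any choice of ε₀, …, ε_m ∈ F×, the set {c ∈ F : f_i(c)·ε_i ∈ F^{×r_i} for all i = 0, …, m} is nonempty. -/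
open Polynomial

/-- A polynomial whose logarithmic derivative has power series coefficients of growth `B ^ n`
has no root of modulus less than `B⁻¹`. -/
lemma one_le_mul_norm_of_isRoot {M : ℂ[X]} (hM : M.coeff 0 ≠ 0) {s : ℕ → ℂ}
    (hrec : (X * derivative M : ℂ[X]) = (M : PowerSeries ℂ) * PowerSeries.mk s)
    {B C : ℝ} (hB : 0 < B) (hs : ∀ n, ‖s n‖ ≤ C * B ^ n) {z : ℂ} (hz : M.IsRoot z) :
    1 ≤ B * ‖z‖ := by
  by_contra! hlt
  have hM0 : M ≠ 0 := by rintro rfl; simp at hM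
  have hz0 : z ≠ 0 := by
    rintro rfl
    exact hM (by rw [coeff_zero_eq_eval_zero]; exact hz)
  have hpoly : ∀ (p : ℂ[X]) (t : ℂ), HasSum (fun n => p.coeff n * t ^ n) (p.eval t) := by
    intro p t
    rw [eval_eq_sum_range]
    refine hasSum_sum_of_ne_finset_zero fun n hn => ?_
    rw [coeff_eq_zero_of_natDegree_lt, zero_mul]
    simpa using hn
  have hsum : ∀ t : ℂ, B * ‖t‖ < 1 → Summable fun n => ‖s n * t ^ n‖ := by
    intro t ht
    refine Summable.of_nonneg_of_le (fun _ => norm_nonneg _) (fun n => ?_)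
      ((summable_geometric_of_lt_one (by positivity) ht).mul_left C)
    rw [norm_mul, norm_pow, mul_pow, ← mul_assoc]
    exact mul_le_mul_of_nonneg_right (hs n) (by positivity)
  have hbound : ∀ t : ℂ, B * ‖t‖ < 1 → ‖∑' n, s n * t ^ n‖ ≤ C * (1 - B * ‖t‖)⁻¹ := by
    intro t ht
    rw [← tsum_geometric_of_lt_one (by positivity) ht, ← tsum_mul_left]
    refine tsum_of_norm_bounded
      ((summable_geometric_of_lt_one (by positivity) ht).mul_left C).hasSum fun n => ?_
    rw [norm_mul, norm_pow, mul_pow, ← mul_assoc]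
    exact mul_le_mul_of_nonneg_right (hs n) (by positivity)
  have hid : ∀ t : ℂ, B * ‖t‖ < 1 →
      t * (derivative M).eval t = M.eval t * ∑' n, s n * t ^ n := by
    intro t ht
    have h1 := (hpoly (X * derivative M) t).tsum_eq
    rw [eval_mul, eval_X] at h1
    have hMn : Summable fun n => ‖M.coeff n * t ^ n‖ := by
      refine summable_of_ne_finset_zero (s := Finset.range (M.natDegree + 1)) fun n hn => ?_
      rw [coeff_eq_zero_of_natDegree_lt, zero_mul, norm_zero]
      simpa using hn
    rw [← h1, ← (hpoly M t).tsum_eq,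
      tsum_mul_tsum_eq_tsum_sum_antidiagonal_of_summable_norm hMn (hsum t ht)]
    refine tsum_congr fun n => ?_
    have h2 := congrArg (PowerSeries.coeff n) hrec
    rw [coeff_coe, PowerSeries.coeff_mul] at h2
    rw [h2, Finset.sum_mul]
    refine Finset.sum_congr rfl fun ij hij => ?_
    rw [← Finset.HasAntidiagonal.mem_antidiagonal.mp hij, pow_add, coeff_coe, PowerSeries.coeff_mk]
    ring
  obtain ⟨N, hN, hNz⟩ := exists_eq_pow_rootMultiplicity_mul_and_not_dvd M hM0 z
  set m := M.rootMultiplicity z with hm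
  have hmpos : 0 < m := (rootMultiplicity_pos hM0).mpr hz
  obtain ⟨m', hm'⟩ : ∃ m', m = m' + 1 := ⟨m - 1, by omega⟩
  rw [dvd_iff_isRoot, IsRoot] at hNz
  have hcont : Filter.Tendsto
      (fun t => t * (m * N.eval t + (t - z) * (derivative N).eval t)) (nhdsWithin z {z}ᶜ)
      (nhds (z * (m * N.eval z + (z - z) * (derivative N).eval z))) := by
    refine Filter.Tendsto.mono_left (Continuous.tendsto ?_ z) nhdsWithin_le_nhds
    fun_prop
  set ρ := (1 + B * ‖z‖) / 2 with hρ
  have hev : ∀ᶠ t in nhdsWithin z {z}ᶜ, B * ‖t‖ < ρ := by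
    refine Filter.Eventually.filter_mono nhdsWithin_le_nhds ?_
    have : Continuous fun t : ℂ => B * ‖t‖ := by fun_prop
    exact this.tendsto z |>.eventually (gt_mem_nhds (by rw [hρ]; linarith))
  have hC : 0 ≤ C := by
    have := (norm_nonneg _).trans (hs 0)
    simpa using this
  have hzero : Filter.Tendsto
      (fun t => t * (m * N.eval t + (t - z) * (derivative N).eval t)) (nhdsWithin z {z}ᶜ)
      (nhds 0) := by
    have hlim : Filter.Tendsto (fun t : ℂ => ‖(t - z) * N.eval t‖ * (C * (1 - ρ)⁻¹))
        (nhdsWithin z {z}ᶜ) (nhds 0) := by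
      have : Continuous fun t : ℂ => ‖(t - z) * N.eval t‖ * (C * (1 - ρ)⁻¹) := by fun_prop
      simpa using (this.tendsto z).mono_left nhdsWithin_le_nhds
    refine squeeze_zero_norm' ?_ hlim
    filter_upwards [hev, self_mem_nhdsWithin] with t ht htz
    have htz' : t - z ≠ 0 := sub_ne_zero.mpr htz
    have hρ1 : ρ < 1 := by rw [hρ]; linarith
    have key : t * (m * N.eval t + (t - z) * (derivative N).eval t)
        = (t - z) * N.eval t * ∑' n, s n * t ^ n := by
      have h := hid t (ht.trans hρ1)
      rw [hN, derivative_mul, derivative_pow, hm'] at h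
      simp only [eval_add, eval_mul, eval_pow, eval_sub, eval_X, eval_C, derivative_sub,
        derivative_X, derivative_C, Nat.add_sub_cancel, sub_zero, mul_one] at h
      have h2 : (t - z) ^ m' ≠ 0 := pow_ne_zero _ htz'
      apply mul_left_cancel₀ h2
      rw [hm']
      linear_combination h
    rw [key, norm_mul]
    refine mul_le_mul_of_nonneg_left ((hbound t (ht.trans hρ1)).trans ?_) (norm_nonneg _)
    refine mul_le_mul_of_nonneg_left ?_ hC
    exact inv_anti₀ (by linarith) (by linarith)
  have huniq := tendsto_nhds_unique hcont hzero
  rw [sub_self, zero_mul, add_zero] at huniq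
  have : (m : ℂ) ≠ 0 := by exact_mod_cast hmpos.ne'
  exact mul_ne_zero hz0 (mul_ne_zero this hNz) huniq

/-- If the logarithmic derivative of `L` has even power series coefficients of growth `B ^ n`,
then the linear coefficient of `L` is at most `B` times the degree. -/
lemma norm_coeff_one_le {L : ℂ[X]} (hL : L.coeff 0 = 1) {s : ℕ → ℂ}
    (hrec : (X * derivative L : ℂ[X]) = (L : PowerSeries ℂ) * PowerSeries.mk s)
    {B C : ℝ} (hB : 0 < B) (hs : ∀ n, Even n → ‖s n‖ ≤ C * B ^ n) :
    ‖L.coeff 1‖ ≤ L.natDegree * B := by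
  have hL0 : L ≠ 0 := by rintro rfl; simp at hL
  have hroot : ∀ z, L.IsRoot z → ‖z⁻¹‖ ≤ B := by
    intro z hz
    have hneg : ∀ p : ℂ[X], ((p.comp (-X) : ℂ[X]) : PowerSeries ℂ)
        = PowerSeries.rescale (-1) (p : PowerSeries ℂ) := by
      intro p
      ext n
      rw [coeff_coe, PowerSeries.coeff_rescale, coeff_coe, ← neg_one_mul (X : ℂ[X]), ← C_1,
        ← C_neg, comp_C_mul_X_coeff, mul_comm]
    have hC : 0 ≤ C := by
      have := (norm_nonneg _).trans (hs 0 (by simp))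
      simpa using this
    have hmain : 1 ≤ B * ‖z‖ := by
      refine one_le_mul_norm_of_isRoot (M := L * L.comp (-X)) (s := fun n => s n + (-1) ^ n * s n)
        (C := 2 * C) ?_ ?_ hB ?_ ?_
      · rw [mul_coeff_zero, hL, coeff_zero_eq_eval_zero, eval_comp]
        simp [← coeff_zero_eq_eval_zero, hL]
      · have e1 : (PowerSeries.mk fun n => s n + (-1) ^ n * s n)
            = PowerSeries.mk s + PowerSeries.rescale (-1) (PowerSeries.mk s) := by
          ext n; simp [PowerSeries.coeff_rescale]
        have e2 := congrArg (PowerSeries.rescale (-1)) hrec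
        rw [← hneg, map_mul, ← hneg] at e2
        have e3 : X * derivative (L * L.comp (-X))
            = (X * derivative L) * L.comp (-X) + L * (X * derivative L).comp (-X) := by
          rw [derivative_mul, derivative_comp, mul_comp, X_comp, derivative_neg, derivative_X]
          ring
        rw [e1, e3, coe_add, coe_mul (X * derivative L), coe_mul L, e2, hrec, coe_mul]
        ring
      · intro n
        rcases Nat.even_or_odd n with h | h
        · rw [h.neg_one_pow, one_mul, ← two_mul, norm_mul, Complex.norm_ofNat, mul_assoc]
          exact mul_le_mul_of_nonneg_left (hs n h) (by norm_num)
        · rw [h.neg_one_pow]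
          simp only [neg_mul, one_mul, add_neg_cancel, norm_zero]
          positivity
      · rw [IsRoot, eval_mul, hz.eq_zero, zero_mul]
    have hzpos : 0 < ‖z‖ := by
      by_contra! h
      nlinarith
    rw [norm_inv, inv_le_comm₀ hzpos hB, inv_le_iff_one_le_mul₀ hB]
    linarith
  have hsplit := IsAlgClosed.splits L
  have h1 : L.coeff 1 = -(L.roots.map fun z => z⁻¹).sum := by
    have h0 : L.eval 0 ≠ 0 := by rw [← coeff_zero_eq_eval_zero, hL]; exact one_ne_zero
    have := hsplit.eval_derivative_div_eval_of_ne_zero h0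
    rw [← coeff_zero_eq_eval_zero, ← coeff_zero_eq_eval_zero, hL, coeff_derivative] at this
    simp only [Nat.cast_zero, zero_add, mul_one, div_one, zero_sub] at this
    rw [this, ← Multiset.sum_map_neg]
    congr 2
    ext z
    simp
  rw [h1, norm_neg]
  refine (norm_multiset_sum_le _).trans ?_
  rw [Multiset.map_map]
  refine (Multiset.sum_le_card_nsmul _ B ?_).trans ?_
  · intro x hx
    obtain ⟨z, hz, rfl⟩ := Multiset.mem_map.mp hx
    exact hroot z (isRoot_of_mem_roots hz)
  · rw [Multiset.card_map, nsmul_eq_mul]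
    exact mul_le_mul_of_nonneg_right (by exact_mod_cast card_roots' L) hB.le

section LFunction

lemma map_pow_of_monic {F : Type*} [Field F] {Λ : F[X] → ℂ} (hone : Λ 1 = 1)
    (hmul : ∀ a b : F[X], a.Monic → b.Monic → Λ (a * b) = Λ a * Λ b) {P : F[X]} (hP : P.Monic)
    (e : ℕ) : Λ (P ^ e) = Λ P ^ e := by
  induction e with
  | zero => simp [hone]
  | succ e ih => rw [pow_succ, hmul _ _ (hP.pow e) hP, ih, pow_succ]

variable {F : Type*} [Field F] [Finite F]

lemma finite_setOf_monic_natDegree_eq (F : Type*) [Field F] [Finite F] (k : ℕ) :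
    {h : F[X] | h.Monic ∧ h.natDegree = k}.Finite := by
  have : Finite (degreeLT F (k + 1)) := Module.finite_of_finite F
  refine (Set.toFinite (degreeLT F (k + 1) : Set F[X])).subset fun h hh => ?_
  rw [SetLike.mem_coe, mem_degreeLT]
  exact lt_of_le_of_lt degree_le_natDegree (by rw [hh.2]; exact_mod_cast Nat.lt_succ_self k)

/-- The monic polynomials of degree `k` over a finite field. -/
noncomputable def monicsOfDegree (F : Type*) [Field F] [Finite F] (k : ℕ) : Finset F[X] :=
  (finite_setOf_monic_natDegree_eq F k).toFinset

lemma mem_monicsOfDegree {k : ℕ} {h : F[X]} :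
    h ∈ monicsOfDegree F k ↔ h.Monic ∧ h.natDegree = k := by
  simp [monicsOfDegree]

open Classical in
/-- The monic irreducible polynomials of degree at most `k` over a finite field. -/
noncomputable def monicIrreduciblesLE (F : Type*) [Field F] [Finite F] (k : ℕ) : Finset F[X] :=
  ((Finset.range (k + 1)).biUnion (monicsOfDegree F)).filter Irreducible

lemma mem_monicIrreduciblesLE {k : ℕ} {P : F[X]} :
    P ∈ monicIrreduciblesLE F k ↔ P.Monic ∧ Irreducible P ∧ P.natDegree ≤ k := by
  simp [monicIrreduciblesLE, mem_monicsOfDegree]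
  tauto

/-- The coefficient of `t ^ k` in the `L`-function of `Λ`. -/
noncomputable def lCoeff (Λ : F[X] → ℂ) (k : ℕ) : ℂ := ∑ h ∈ monicsOfDegree F k, Λ h

/-- The coefficient of `t ^ n` in the logarithmic derivative of the `L`-function of `Λ`. -/
noncomputable def lLogCoeff (Λ : F[X] → ℂ) (n : ℕ) : ℂ :=
  ∑ P ∈ monicIrreduciblesLE F n with P.natDegree ∣ n, P.natDegree * Λ P ^ (n / P.natDegree)

open Classical in
lemma card_filter_pow_dvd {k : ℕ} {h P : F[X]} (hh : h ∈ monicsOfDegree F k) (hP : P.Monic)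
    (hPi : Irreducible P) :
    ((Finset.range (k + 1)).filter
      (fun j => (j ≠ 0 ∧ P.natDegree ∣ j) ∧ P ^ (j / P.natDegree) ∣ h)).card
      = (UniqueFactorizationMonoid.normalizedFactors h).count P := by
  obtain ⟨hm, hd⟩ := mem_monicsOfDegree.mp hh
  have hpos : 0 < P.natDegree := hPi.natDegree_pos
  set m := (UniqueFactorizationMonoid.normalizedFactors h).count P with hmdef
  have hiff : ∀ e, P ^ e ∣ h ↔ e ≤ m := by
    intro e
    rw [← ENat.natCast_le_natCast, hmdef,
      ← hP.normalize_eq_self,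
      ← UniqueFactorizationMonoid.emultiplicity_eq_count_normalizedFactors hPi hm.ne_zero,
      hP.normalize_eq_self, pow_dvd_iff_le_emultiplicity]
  have : (Finset.range (k + 1)).filter
      (fun j => (j ≠ 0 ∧ P.natDegree ∣ j) ∧ P ^ (j / P.natDegree) ∣ h)
      = (Finset.Icc 1 m).image (fun e => P.natDegree * e) := by
    ext j
    simp only [Finset.mem_filter, Finset.mem_range, Finset.mem_image, Finset.mem_Icc]
    constructor
    · rintro ⟨_, ⟨h0, e, rfl⟩, h2⟩
      rw [Nat.mul_div_cancel_left _ hpos, hiff] at h2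
      refine ⟨e, ⟨?_, h2⟩, rfl⟩
      rcases Nat.eq_zero_or_pos e with rfl | he
      · simp at h0
      · exact he
    · rintro ⟨e, ⟨h1, h2⟩, rfl⟩
      refine ⟨?_, ⟨by positivity, dvd_mul_right _ _⟩, ?_⟩
      · have := natDegree_le_of_dvd ((hiff e).mpr h2) hm.ne_zero
        rw [natDegree_pow, hd] at this
        rw [mul_comm]
        omega
      · rwa [Nat.mul_div_cancel_left _ hpos, hiff]
  rw [this, Finset.card_image_of_injective, Nat.card_Icc, Nat.add_sub_cancel]
  exact fun a b hab => Nat.eq_of_mul_eq_mul_left hpos hab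

open Classical in
lemma natDegree_eq_sum_prime_powers {k : ℕ} {h : F[X]} (hh : h ∈ monicsOfDegree F k) :
    k = ∑ P ∈ monicIrreduciblesLE F k, ∑ j ∈ Finset.range (k + 1),
      if (j ≠ 0 ∧ P.natDegree ∣ j) ∧ P ^ (j / P.natDegree) ∣ h then P.natDegree else 0 := by
  obtain ⟨hm, hd⟩ := mem_monicsOfDegree.mp hh
  have h1 : ∀ P ∈ monicIrreduciblesLE F k, (∑ j ∈ Finset.range (k + 1),
      if (j ≠ 0 ∧ P.natDegree ∣ j) ∧ P ^ (j / P.natDegree) ∣ h then P.natDegree else 0)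
      = (UniqueFactorizationMonoid.normalizedFactors h).count P * P.natDegree := by
    intro P hP
    obtain ⟨hPm, hPi, _⟩ := mem_monicIrreduciblesLE.mp hP
    rw [← card_filter_pow_dvd hh hPm hPi, ← Finset.sum_filter, Finset.sum_const, smul_eq_mul]
  rw [Finset.sum_congr rfl h1]
  have h2 : (UniqueFactorizationMonoid.normalizedFactors h).prod = h := by
    rw [UniqueFactorizationMonoid.prod_normalizedFactors_eq hm.ne_zero, hm.normalize_eq_self]
  have h3 : ((UniqueFactorizationMonoid.normalizedFactors h).map natDegree).sum = k := by
    rw [← natDegree_multiset_prod _ (UniqueFactorizationMonoid.zero_notMem_normalizedFactors h),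
      h2, hd]
  rw [Finset.sum_multiset_map_count] at h3
  conv_lhs => rw [← h3]
  simp only [smul_eq_mul]
  refine Finset.sum_subset (fun P hP => ?_) fun P _ hP => ?_
  · rw [Multiset.mem_toFinset] at hP
    have hPi := UniqueFactorizationMonoid.irreducible_of_normalized_factor P hP
    refine mem_monicIrreduciblesLE.mpr ⟨?_, hPi, ?_⟩
    · rw [← UniqueFactorizationMonoid.normalize_normalized_factor P hP]
      exact monic_normalize hPi.ne_zero
    · rw [← hd]
      exact natDegree_le_of_dvd (UniqueFactorizationMonoid.dvd_of_mem_normalizedFactors hP)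
        hm.ne_zero
  · rw [Multiset.mem_toFinset] at hP
    rw [Multiset.count_eq_zero.mpr hP, zero_mul]

open Classical in
lemma sum_filter_dvd_monicsOfDegree {Λ : F[X] → ℂ}
    (hmul : ∀ a b : F[X], a.Monic → b.Monic → Λ (a * b) = Λ a * Λ b)
    {i j : ℕ} {Q : F[X]} (hQ : Q ∈ monicsOfDegree F j) :
    ∑ h ∈ monicsOfDegree F (i + j) with Q ∣ h, Λ h = lCoeff Λ i * Λ Q := by
  obtain ⟨hQm, hQd⟩ := mem_monicsOfDegree.mp hQ
  have : (monicsOfDegree F (i + j)).filter (Q ∣ ·) = (monicsOfDegree F i).image (· * Q) := by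
    ext h
    simp only [Finset.mem_filter, Finset.mem_image, mem_monicsOfDegree]
    constructor
    · rintro ⟨⟨hm, hd⟩, c, rfl⟩
      have hc : c.Monic := hQm.of_mul_monic_left hm
      rw [hQm.natDegree_mul hc] at hd
      exact ⟨c, ⟨hc, by omega⟩, mul_comm _ _⟩
    · rintro ⟨c, ⟨hc, hd⟩, rfl⟩
      exact ⟨⟨hc.mul hQm, by rw [hc.natDegree_mul hQm, hd, hQd]⟩, dvd_mul_left _ _⟩
  rw [this, Finset.sum_image fun a _ b _ hab => mul_right_cancel₀ hQm.ne_zero hab, lCoeff,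
    Finset.sum_mul]
  exact Finset.sum_congr rfl fun h hh => hmul _ _ (mem_monicsOfDegree.mp hh).1 hQm

lemma natCast_mul_lCoeff {Λ : F[X] → ℂ} (hone : Λ 1 = 1)
    (hmul : ∀ a b : F[X], a.Monic → b.Monic → Λ (a * b) = Λ a * Λ b) (k : ℕ) :
    k * lCoeff Λ k
      = ∑ ij ∈ Finset.HasAntidiagonal.antidiagonal k, lCoeff Λ ij.1 * lLogCoeff Λ ij.2 := by
  classical
  have hlog : ∀ j ≤ k, lLogCoeff Λ j = ∑ P ∈ monicIrreduciblesLE F k,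
      if j ≠ 0 ∧ P.natDegree ∣ j then (P.natDegree : ℂ) * Λ P ^ (j / P.natDegree) else 0 := by
    intro j hj
    rw [lLogCoeff, ← Finset.sum_filter]
    refine Finset.sum_congr ?_ fun _ _ => rfl
    ext P
    simp only [Finset.mem_filter, mem_monicIrreduciblesLE]
    constructor
    · rintro ⟨⟨hm, hi, hd⟩, hdvd⟩
      exact ⟨⟨hm, hi, hd.trans hj⟩, by have := hi.natDegree_pos; omega, hdvd⟩
    · rintro ⟨⟨hm, hi, hd⟩, h0, hdvd⟩
      exact ⟨⟨hm, hi, Nat.le_of_dvd (by omega) hdvd⟩, hdvd⟩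
  have hL : k * lCoeff Λ k = ∑ P ∈ monicIrreduciblesLE F k, ∑ j ∈ Finset.range (k + 1),
      if j ≠ 0 ∧ P.natDegree ∣ j then
        lCoeff Λ (k - j) * ((P.natDegree : ℂ) * Λ P ^ (j / P.natDegree)) else 0 := by
    rw [lCoeff, Finset.mul_sum]
    have h1 : ∀ h ∈ monicsOfDegree F k, k * Λ h = ∑ P ∈ monicIrreduciblesLE F k,
        ∑ j ∈ Finset.range (k + 1), if j ≠ 0 ∧ P.natDegree ∣ j then
          (if P ^ (j / P.natDegree) ∣ h then (P.natDegree : ℂ) * Λ h else 0) else 0 := by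
      intro h hh
      conv_lhs => rw [natDegree_eq_sum_prime_powers hh]
      push_cast
      rw [Finset.sum_mul]
      refine Finset.sum_congr rfl fun P _ => ?_
      rw [Finset.sum_mul]
      refine Finset.sum_congr rfl fun j _ => ?_
      rw [ite_and, ite_mul, zero_mul, ite_mul, zero_mul]
    rw [Finset.sum_congr rfl h1, Finset.sum_comm]
    refine Finset.sum_congr rfl fun P hP => ?_
    obtain ⟨hPm, hPi, _⟩ := mem_monicIrreduciblesLE.mp hP
    rw [Finset.sum_comm]
    refine Finset.sum_congr rfl fun j hj => ?_
    split_ifs with hc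
    · have hj : j ≤ k := by simpa [Nat.lt_succ_iff] using hj
      have hQ : P ^ (j / P.natDegree) ∈ monicsOfDegree F j :=
        mem_monicsOfDegree.mpr ⟨hPm.pow _, by rw [natDegree_pow, Nat.div_mul_cancel hc.2]⟩
      have := sum_filter_dvd_monicsOfDegree hmul (i := k - j) hQ
      rw [Nat.sub_add_cancel hj, map_pow_of_monic hone hmul hPm] at this
      rw [← Finset.sum_filter, ← Finset.mul_sum, this]
      ring
    · simp
  rw [hL, Finset.sum_comm, ← Finset.Nat.sum_antidiagonal_swap,
    Finset.Nat.sum_antidiagonal_eq_sum_range_succ_mk]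
  refine Finset.sum_congr rfl fun j hj => ?_
  have hj : j ≤ k := by simpa [Nat.lt_succ_iff] using hj
  simp only [Prod.swap_prod_mk]
  rw [hlog j hj, Finset.mul_sum]
  refine Finset.sum_congr rfl fun P _ => ?_
  rw [mul_ite, mul_zero]

lemma lCoeff_eq_zero {Λ : F[X] → ℂ} 
    (hmul : ∀ a b : F[X], a.Monic → b.Monic → Λ (a * b) = Λ a * Λ b)
    {f : F[X]} (hf : f.Monic)
    (hmod : ∀ a b : F[X], a.Monic → b.Monic → f ∣ a - b → Λ a = Λ b)
    {u : F[X]} (hu : u.Monic) (huf : IsCoprime f u) (hu1 : Λ u ≠ 1)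
    {k : ℕ} (hk : f.natDegree ≤ k) : lCoeff Λ k = 0 := by
  classical
  set φ : F[X] → F[X] := fun h => h - h %ₘ f + (u * h) %ₘ f with hφ
  have hdeg : ∀ h : F[X], h.Monic → h.natDegree = k → ∀ s,
      h ≠ 0 ∧ (s %ₘ f).degree < h.degree := by
    intro h hm hd s
    refine ⟨hm.ne_zero, (degree_modByMonic_lt s hf).trans_le ?_⟩
    rw [degree_eq_natDegree hf.ne_zero, degree_eq_natDegree hm.ne_zero, hd]
    exact_mod_cast hk
  have hmaps : ∀ h ∈ monicsOfDegree F k, φ h ∈ monicsOfDegree F k := by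
    intro h hh
    obtain ⟨hm, hd⟩ := mem_monicsOfDegree.mp hh
    have e : φ h = h + ((u * h - h) %ₘ f) := by
      rw [hφ, sub_modByMonic]; ring
    have hlt := (hdeg h hm hd (u * h - h)).2
    rw [mem_monicsOfDegree, e]
    exact ⟨hm.add_of_left hlt, by rw [natDegree_add_eq_left_of_degree_lt hlt, hd]⟩
  have hcong : ∀ h, f ∣ φ h - u * h := by
    intro h
    have h1 := modByMonic_add_div h f
    have h2 := modByMonic_add_div (u * h) f
    refine ⟨h /ₘ f - (u * h) /ₘ f, ?_⟩
    rw [hφ]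
    linear_combination h2 - h1
  have hinj : Set.InjOn φ (monicsOfDegree F k) := by
    intro a _ b _ hab
    have h1 : f ∣ u * (a - b) := by
      have := dvd_sub (hcong b) (hcong a)
      rw [hab] at this
      convert this using 1
      ring
    have h2 : a %ₘ f = b %ₘ f := by
      have := huf.dvd_of_dvd_mul_left h1
      rwa [← modByMonic_eq_zero_iff_dvd hf, sub_modByMonic, sub_eq_zero] at this
    have h3 : (u * a) %ₘ f = (u * b) %ₘ f := by
      rw [← sub_eq_zero, ← sub_modByMonic, modByMonic_eq_zero_iff_dvd hf, ← mul_sub]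
      exact h1
    simp only [hφ, h2, h3] at hab
    linear_combination hab
  have hsum : lCoeff Λ k = Λ u * lCoeff Λ k := by
    have himg : (monicsOfDegree F k).image φ = monicsOfDegree F k :=
      Finset.eq_of_subset_of_card_le (Finset.image_subset_iff.mpr hmaps)
        (by rw [Finset.card_image_of_injOn hinj])
    conv_lhs => rw [lCoeff, ← himg, Finset.sum_image hinj]
    rw [lCoeff, Finset.mul_sum]
    refine Finset.sum_congr rfl fun h hh => ?_
    have hm := (mem_monicsOfDegree.mp hh).1
    rw [← hmul _ _ hu hm]
    exact hmod _ _ (mem_monicsOfDegree.mp (hmaps h hh)).1 (hu.mul hm) (hcong h)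
  by_contra h0
  exact hu1 (mul_right_cancel₀ h0 (by rw [one_mul, ← hsum]))

/-- The sum over the monic linear polynomials of a nontrivial character modulo `f` is at most
`deg f * B`, where `B` is the growth rate of the logarithmic coefficients of its `L`-function. -/
lemma norm_lCoeff_one_le {Λ : F[X] → ℂ} (hone : Λ 1 = 1)
    (hmul : ∀ a b : F[X], a.Monic → b.Monic → Λ (a * b) = Λ a * Λ b)
    {f : F[X]} (hf : f.Monic)
    (hmod : ∀ a b : F[X], a.Monic → b.Monic → f ∣ a - b → Λ a = Λ b)
    {u : F[X]} (hu : u.Monic) (huf : IsCoprime f u) (hu1 : Λ u ≠ 1)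
    {B C : ℝ} (hB : 0 < B) (hs : ∀ n, Even n → ‖lLogCoeff Λ n‖ ≤ C * B ^ n) :
    ‖lCoeff Λ 1‖ ≤ f.natDegree * B := by
  set L : ℂ[X] := ∑ k ∈ Finset.range f.natDegree, monomial k (lCoeff Λ k) with hLdef
  have hcoeff : ∀ k, L.coeff k = lCoeff Λ k := by
    intro k
    rw [hLdef, finsetSum_coeff]
    simp only [coeff_monomial, Finset.sum_ite_eq', Finset.mem_range]
    split_ifs with h
    · rfl
    · rw [lCoeff_eq_zero hmul hf hmod hu huf hu1 (by omega)]
  have h0 : L.coeff 0 = 1 := by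
    rw [hcoeff, lCoeff]
    have : monicsOfDegree F 0 = {1} := by
      ext h
      rw [mem_monicsOfDegree, Finset.mem_singleton]
      constructor
      · rintro ⟨hm, hd⟩
        exact hm.natDegree_eq_zero.mp hd
      · rintro rfl
        exact ⟨monic_one, natDegree_one⟩
    rw [this, Finset.sum_singleton, hone]
  have hrec : (X * derivative L : ℂ[X]) = (L : PowerSeries ℂ) * PowerSeries.mk (lLogCoeff Λ) := by
    ext k
    rw [coeff_coe, PowerSeries.coeff_mul]
    have := natCast_mul_lCoeff hone hmul k
    simp only [coeff_coe, hcoeff, PowerSeries.coeff_mk]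
    rw [← this]
    cases k with
    | zero => simp
    | succ k => rw [coeff_X_mul, coeff_derivative, hcoeff]; push_cast; ring
  rw [← hcoeff]
  refine (norm_coeff_one_le h0 hrec hB hs).trans
    (mul_le_mul_of_nonneg_right ?_ hB.le)
  have : L.natDegree ≤ f.natDegree := by
    refine natDegree_le_iff_coeff_eq_zero.mpr fun k hk => ?_
    rw [hcoeff, lCoeff_eq_zero hmul hf hmod hu huf hu1 hk.le]
  exact_mod_cast this

end LFunction

section Stepanov

variable {K : Type*} [Field K]

/-- If no proper power of `g` is an `e`-th power up to a constant, then `Y ^ e - γ / g` is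
irreducible over the field of rational functions. -/
lemma irreducible_X_pow_sub_C_div {L : Type*} [Field L] [Algebra K[X] L] [IsFractionRing K[X] L]
    {e : ℕ} (he : 0 < e) {g : K[X]} (hg0 : g ≠ 0)
    (hg : ∀ (s : ℕ) (c : K[X]) (γ : K), γ ≠ 0 → c ^ e = C γ * g ^ s → e ∣ s) {γ : K} (hγ : γ ≠ 0) :
    Irreducible (X ^ e - C (algebraMap K[X] L (C γ) / algebraMap K[X] L g) : L[X]) := by
  have hinj : Function.Injective (algebraMap K[X] L) := IsFractionRing.injective K[X] L
  set a : L := algebraMap K[X] L (C γ) / algebraMap K[X] L g with ha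
  have ha0 : a ≠ 0 := by
    rw [ha]
    refine div_ne_zero ?_ ?_ <;> rw [Ne, map_eq_zero_iff _ hinj]
    · simpa using hγ
    · exact hg0
  have hmonic : (X ^ e - C a : L[X]).Monic := monic_X_pow_sub_C a he.ne'
  have hnd : (X ^ e - C a : L[X]).natDegree = e := natDegree_X_pow_sub_C
  obtain ⟨P, hPm, hPi, hPd⟩ := exists_monic_irreducible_factor (X ^ e - C a) (by
    refine not_isUnit_of_natDegree_pos _ (by omega))
  set s := P.natDegree with hs
  let Ω := AlgebraicClosure L
  have hsplit : (P.map (algebraMap L Ω)).Splits := IsAlgClosed.splits _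
  have hroots : ∀ ρ ∈ (P.map (algebraMap L Ω)).roots, ρ ^ e = algebraMap L Ω a := by
    intro ρ hρ
    have h1 : (P.map (algebraMap L Ω)).eval ρ = 0 := isRoot_of_mem_roots hρ
    obtain ⟨Q, hQ⟩ := hPd
    have h2 := congrArg (fun p => (p.map (algebraMap L Ω)).eval ρ) hQ
    simp only [Polynomial.map_sub, Polynomial.map_pow, map_X, map_C, eval_sub, eval_pow, eval_X,
      eval_C, Polynomial.map_mul, eval_mul, h1, zero_mul] at h2
    exact sub_eq_zero.mp h2
  have hc0 : P.coeff 0 ^ e = ((-1) ^ s) ^ e * a ^ s := by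
    apply (algebraMap L Ω).injective
    have h1 := hsplit.coeff_zero_eq_prod_roots_of_monic (hPm.map _)
    rw [coeff_map, natDegree_map] at h1
    have h2 : (P.map (algebraMap L Ω)).roots.prod ^ e
        = algebraMap L Ω a ^ Multiset.card (P.map (algebraMap L Ω)).roots := by
      rw [← Multiset.map_id (P.map (algebraMap L Ω)).roots, ← Multiset.prod_map_pow]
      simp only [id]
      rw [Multiset.map_congr rfl hroots, Multiset.map_const', Multiset.prod_replicate,
        Multiset.map_id']
    rw [map_pow, h1, mul_pow, h2, ← hsplit.natDegree_eq_card_roots, natDegree_map]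
    simp [hs]
  have hc0' : P.coeff 0 ≠ 0 := by
    intro h
    rw [h, zero_pow he.ne'] at hc0
    exact mul_ne_zero (pow_ne_zero _ (pow_ne_zero _ (by simp))) (pow_ne_zero _ ha0) hc0.symm
  have hinv : (P.coeff 0)⁻¹ ^ e = algebraMap K[X] L (C ((((-1) ^ s) ^ e * γ ^ s)⁻¹) * g ^ s) := by
    have hgL : algebraMap K[X] L g ≠ 0 := by rwa [Ne, map_eq_zero_iff _ hinj]
    have hγL : algebraMap K[X] L (C γ) ≠ 0 := by rw [Ne, map_eq_zero_iff _ hinj]; simpa using hγ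
    have h1 : algebraMap K[X] L (C ((((-1) ^ s) ^ e * γ ^ s)⁻¹))
        * algebraMap K[X] L (C (((-1) ^ s) ^ e * γ ^ s)) = 1 := by
      rw [← map_mul, ← C_mul, inv_mul_cancel₀, C_1, map_one]
      exact mul_ne_zero (pow_ne_zero _ (pow_ne_zero _ (by simp))) (pow_ne_zero _ hγ)
    rw [inv_pow, hc0, inv_eq_iff_eq_inv, map_mul, map_pow]
    apply eq_inv_of_mul_eq_one_left
    rw [ha, div_pow]
    simp only [map_pow, map_mul (algebraMap K[X] L), C_mul, map_neg, map_one] at h1 ⊢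
    generalize algebraMap K[X] L (C ((((-1) ^ s) ^ e * γ ^ s)⁻¹)) = w at h1 ⊢
    field_simp
    linear_combination h1
  have hintegral : IsIntegral K[X] (P.coeff 0)⁻¹ := by
    refine IsIntegral.of_pow he ?_
    rw [hinv]
    exact isIntegral_algebraMap
  obtain ⟨c, hc⟩ := IsIntegrallyClosed.isIntegral_iff.mp hintegral
  have hdvd : e ∣ s := by
    refine hg s c ((((-1) ^ s) ^ e * γ ^ s)⁻¹) ?_ (hinj ?_)
    · exact inv_ne_zero (mul_ne_zero (pow_ne_zero _ (pow_ne_zero _ (by simp))) (pow_ne_zero _ hγ))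
    · rw [map_pow, hc, hinv]
  have hle : s ≤ e := hnd ▸ natDegree_le_of_dvd hPd hmonic.ne_zero
  have hse : e ≤ s := Nat.le_of_dvd hPi.natDegree_pos hdvd
  have : P = X ^ e - C a :=
    (eq_of_monic_of_dvd_of_natDegree_le hPm hmonic hPd (by rw [hnd]; exact hse)).symm
  rwa [← this]

/-- The matrix of multiplication by `g * ∑ uᵢ Yⁱ` in the basis `Yⁱ`, where `g * Y ^ e = γ`. -/
noncomputable def twistedMulMatrix {R : Type*} [CommRing R] {e : ℕ} (g γ : R) (u : Fin e → R) :
    Matrix (Fin e) (Fin e) R :=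
  Matrix.of fun j k => ∑ i, u i *
    if (i + j : ℕ) = k then g else if (i + j : ℕ) = k + e then γ else 0

lemma sum_twistedMulMatrix {R S : Type*} [CommRing R] [CommRing S] (φ : R →+* S) {e : ℕ}
    {g γ : R} {y : S} (hy : φ g * y ^ e = φ γ) (u : Fin e → R) (j : Fin e) :
    ∑ k, φ (twistedMulMatrix g γ u j k) * y ^ (k : ℕ)
      = φ g * y ^ (j : ℕ) * ∑ i, φ (u i) * y ^ (i : ℕ) := by
  simp only [twistedMulMatrix, Matrix.of_apply, map_sum, map_mul, Finset.sum_mul, Finset.mul_sum]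
  rw [Finset.sum_comm]
  refine Finset.sum_congr rfl fun i _ => ?_
  by_cases h : (i + j : ℕ) < e
  · rw [Finset.sum_eq_single ⟨i + j, h⟩]
    · simp [pow_add]; ring
    · intro k _ hk
      have h1 : (i + j : ℕ) ≠ k := fun h' => hk (Fin.ext h'.symm)
      have h2 : (i + j : ℕ) ≠ k + e := by omega
      simp [h1, h2]
    · simp
  · have hlt : (i + j : ℕ) - e < e := by omega
    rw [Finset.sum_eq_single ⟨i + j - e, hlt⟩]
    · have h1 : (i + j : ℕ) ≠ i + j - e := by omega
      have h2 : (i + j : ℕ) = i + j - e + e := by omega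
      have h3 : y ^ (j : ℕ) * y ^ (i : ℕ) = y ^ (i + j - e : ℕ) * y ^ e := by
        rw [← pow_add, ← pow_add]
        congr 1
        omega
      rw [if_neg h1, if_pos h2, ← hy]
      linear_combination - φ g * φ (u i) * h3
    · intro k _ hk
      have h1 : (i + j : ℕ) ≠ k := by omega
      have h2 : (i + j : ℕ) ≠ k + e := fun h' => hk (Fin.ext (by simp; omega))
      simp [h1, h2]
    · simp

lemma natDegree_det_le {R : Type*} [CommRing R] {e : ℕ} (M : Matrix (Fin e) (Fin e) R[X]) {d : ℕ}
    (hM : ∀ i j, (M i j).natDegree ≤ d) : M.det.natDegree ≤ e * d := by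
  rw [Matrix.det_apply]
  refine natDegree_sum_le_of_forall_le _ _ fun σ _ => ?_
  refine (natDegree_smul_le _ _).trans ((natDegree_prod_le _ _).trans ?_)
  exact (Finset.sum_le_card_nsmul _ _ d fun i _ => hM _ _).trans (by simp)

lemma eq_zero_of_X_sub_C_pow_dvd_sum {p μ : ℕ} [Fact p.Prime] [CharP K p] {e b A : ℕ}
    (he : 0 < e) (hb : p ^ μ = e * b + 1) {g : K[X]}
    (hg : ∀ (s : ℕ) (c : K[X]) (γ : K), γ ≠ 0 → c ^ e = C γ * g ^ s → e ∣ s)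
    {x₀ : K} (hx₀ : g.eval x₀ ≠ 0) {u : Fin e → K[X]} (hu : ∀ i, (u i).natDegree ≤ A)
    (hA : e * (A + g.natDegree) < p ^ μ)
    (hdvd : (X - C x₀) ^ (p ^ μ) ∣ ∑ i, u i * (g ^ b) ^ (i : ℕ)) : u = 0 := by
  have hg0 : g ≠ 0 := by rintro rfl; simp at hx₀
  set γ : K := g.eval x₀ ^ p ^ μ with hγdef
  have hγ : γ ≠ 0 := pow_ne_zero _ hx₀
  set T : K[X] := (X - C x₀) ^ (p ^ μ) with hT
  set M := twistedMulMatrix g (C γ) u with hM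
  have hdet_dvd : T ∣ M.det := by
    let φ := Ideal.Quotient.mk (Ideal.span {T})
    have hφ : ∀ a, φ a = 0 ↔ T ∣ a := fun a => Ideal.Quotient.eq_zero_iff_dvd _ _
    have hy : φ g * φ (g ^ b) ^ e = φ (C γ) := by
      rw [← map_pow, ← map_mul, ← sub_eq_zero, ← map_sub, hφ]
      have h1 : g * (g ^ b) ^ e - C γ = (g - C (g.eval x₀)) ^ p ^ μ := by
        rw [sub_pow_char_pow, ← C_pow, ← hγdef, hb]
        ring
      rw [h1]
      exact pow_dvd_pow_of_dvd (dvd_iff_isRoot.mpr (by simp)) _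
    have h1 : (φ.mapMatrix M).mulVec (fun k => φ (g ^ b) ^ (k : ℕ)) = 0 := by
      ext j
      have := sum_twistedMulMatrix φ hy u j
      simp only [Matrix.mulVec, dotProduct, RingHom.mapMatrix_apply, Matrix.map_apply]
      rw [this, Pi.zero_apply]
      have h2 : ∑ i, φ (u i) * φ (g ^ b) ^ (i : ℕ) = 0 := by
        simpa only [map_sum, map_mul, map_pow] using (hφ _).mpr hdvd
      rw [h2, mul_zero]
    have h2 := congrArg (φ.mapMatrix M).adjugate.mulVec h1
    rw [Matrix.mulVec_mulVec, Matrix.adjugate_mul, Matrix.smul_mulVec, Matrix.one_mulVec,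
      Matrix.mulVec_zero] at h2
    have h3 := congrFun h2 ⟨0, he⟩
    simp only [Pi.smul_apply, pow_zero, smul_eq_mul, mul_one, Pi.zero_apply] at h3
    rwa [← RingHom.map_det, hφ] at h3
  have hdet : M.det = 0 := by
    refine eq_zero_of_dvd_of_natDegree_lt hdet_dvd ?_
    rw [hT, natDegree_pow, natDegree_X_sub_C, mul_one]
    refine (natDegree_det_le M (d := A + g.natDegree) fun j k => ?_).trans_lt hA
    rw [hM, twistedMulMatrix, Matrix.of_apply]
    refine natDegree_sum_le_of_forall_le _ _ fun i _ => ?_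
    refine natDegree_mul_le.trans (add_le_add (hu i) ?_)
    split_ifs <;> simp
  obtain ⟨z, hz0, hz⟩ := Matrix.exists_vecMul_eq_zero_iff.mpr hdet
  let L := FractionRing K[X]
  have hinj : Function.Injective (algebraMap K[X] L) := IsFractionRing.injective K[X] L
  set f : L[X] := X ^ e - C (algebraMap K[X] L (C γ) / algebraMap K[X] L g) with hf
  have hirr : Irreducible f := irreducible_X_pow_sub_C_div he hg0 hg hγ
  have : Fact (Irreducible f) := ⟨hirr⟩
  let φ : K[X] →+* AdjoinRoot f := (AdjoinRoot.of f).comp (algebraMap K[X] L)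
  have hgL : algebraMap K[X] L g ≠ 0 := by rwa [Ne, map_eq_zero_iff _ hinj]
  have hφg : φ g ≠ 0 := by
    simp only [φ, RingHom.comp_apply]
    rwa [Ne, map_eq_zero]
  have hy : φ g * AdjoinRoot.root f ^ e = φ (C γ) := by
    have h1 : AdjoinRoot.root f ^ e
        = AdjoinRoot.of f (algebraMap K[X] L (C γ) / algebraMap K[X] L g) := by
      have := AdjoinRoot.eval₂_root f
      rw [hf, eval₂_sub, eval₂_pow, eval₂_X, eval₂_C, sub_eq_zero] at this
      exact this
    rw [h1]
    simp only [φ, RingHom.comp_apply]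
    rw [← map_mul, mul_div_cancel₀ _ hgL]
  have hindep : ∀ v : Fin e → K[X], ∑ i, φ (v i) * AdjoinRoot.root f ^ (i : ℕ) = 0 → v = 0 := by
    intro v hv
    set q : L[X] := ∑ i, C (algebraMap K[X] L (v i)) * X ^ (i : ℕ) with hq
    have h1 : AdjoinRoot.mk f q = 0 := by
      rw [← hv, hq, map_sum]
      refine Finset.sum_congr rfl fun i _ => ?_
      rw [map_mul, map_pow, AdjoinRoot.mk_C, AdjoinRoot.mk_X]
      rfl
    have h2 : q = 0 := by
      refine eq_zero_of_dvd_of_degree_lt (AdjoinRoot.mk_eq_zero.mp h1) ?_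
      rw [hf, degree_X_pow_sub_C he]
      refine (degree_sum_le _ _).trans_lt ((Finset.sup_lt_iff (WithBot.bot_lt_coe _)).mpr ?_)
      intro i _
      exact (degree_C_mul_X_pow_le _ _).trans_lt (by exact_mod_cast i.2)
    ext1 i
    have h3 := congrArg (fun p => p.coeff (i : ℕ)) h2
    simp only [hq, finsetSum_coeff, coeff_C_mul, coeff_X_pow, coeff_zero] at h3
    rw [Finset.sum_eq_single i] at h3
    · simpa [map_eq_zero_iff _ hinj] using h3
    · intro j _ hj
      have : (i : ℕ) ≠ j := fun h => hj (Fin.ext h.symm)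
      simp [this]
    · simp
  have hprod : φ g * (∑ j, φ (z j) * AdjoinRoot.root f ^ (j : ℕ))
      * (∑ i, φ (u i) * AdjoinRoot.root f ^ (i : ℕ)) = 0 := by
    have h1 : ∑ j, φ (z j) * ∑ k, φ (M j k) * AdjoinRoot.root f ^ (k : ℕ) = 0 := by
      have h2 : ∑ k, φ (Matrix.vecMul z M k) * AdjoinRoot.root f ^ (k : ℕ) = 0 := by simp [hz]
      rw [← h2]
      simp only [Matrix.vecMul, dotProduct, map_sum, map_mul, Finset.mul_sum, Finset.sum_mul]
      rw [Finset.sum_comm]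
      simp only [mul_assoc]
    rw [← h1]
    simp only [hM, sum_twistedMulMatrix φ hy u]
    rw [mul_assoc, Finset.sum_mul, Finset.mul_sum]
    refine Finset.sum_congr rfl fun j _ => ?_
    ring
  rcases mul_eq_zero.mp hprod with h | h
  · exact absurd (hindep z ((mul_eq_zero.mp h).resolve_left hφg)) hz0
  · exact hindep u h

lemma eq_zero_of_sum_pow_mul_eq_zero {R : Type*} [CommRing R] [IsDomain R] {t : R} (ht : t ≠ 0)
    {J : ℕ} (v : Fin J → R) (hv : ∀ j, t ∣ v j → v j = 0)
    (hsum : ∑ j : Fin J, t ^ (j : ℕ) * v j = 0) :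
    ∀ j, v j = 0 := by
  induction J with
  | zero => exact fun j => j.elim0
  | succ J ih =>
    rw [Fin.sum_univ_succ] at hsum
    have h1 : ∑ j : Fin J, t ^ (j.succ : ℕ) * v j.succ
        = t * ∑ j : Fin J, t ^ (j : ℕ) * v j.succ := by
      rw [Finset.mul_sum]
      refine Finset.sum_congr rfl fun j _ => ?_
      rw [Fin.val_succ]
      ring
    rw [h1, Fin.val_zero, pow_zero, one_mul] at hsum
    have h0 : v 0 = 0 := hv 0 ⟨-∑ j : Fin J, t ^ (j : ℕ) * v j.succ, by linear_combination hsum⟩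
    rw [h0, zero_add] at hsum
    exact Fin.cases h0 (ih _ (fun j => hv _) ((mul_eq_zero.mp hsum).resolve_left ht))

lemma card_eval_pow_eq_le [Fintype K] [DecidableEq K] {p μ : ℕ} [Fact p.Prime] [CharP K p]
    (hK : Fintype.card K = (p ^ μ) ^ 2) {e b A J : ℕ}
    (he : 0 < e) (hb : p ^ μ = e * b + 1) {g : K[X]}
    (hg : ∀ (s : ℕ) (c : K[X]) (γ : K), γ ≠ 0 → c ^ e = C γ * g ^ s → e ∣ s)
    {x₀ : K} (hx₀ : g.eval x₀ ≠ 0) (hA : A + g.natDegree ≤ b)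
    (hD : p ^ μ * A + J + g.natDegree * p ^ μ < e * J * A) (ζ : K) :
    Finset.card {x : K | g.eval x ≠ 0 ∧ g.eval x ^ (b * (p ^ μ + 1)) = ζ}
      ≤ p ^ μ * J + A + p ^ μ * g.natDegree := by
  set ℓ := p ^ μ with hℓ
  set r := g.natDegree with hr
  set T : K[X] := X - C x₀ with hT
  set D := ℓ * A + J + r * ℓ with hDdef
  have hebℓ : ∀ i : Fin e, i * b ≤ ℓ := fun i => by
    rw [hb]; exact (Nat.mul_le_mul_right b i.2.le).trans (Nat.le_succ _)
  let w : Fin e × Fin J × Fin A → K[X] := fun i =>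
    C (ζ ^ (i.1 : ℕ)) * X ^ ((i.2.2 : ℕ) * ℓ) * T ^ (i.2.1 : ℕ) * g ^ ((e - 1 - i.1 : ℕ) * b)
  have hw : ∀ i, w i ∈ degreeLT K D := by
    intro i
    rw [mem_degreeLT]
    refine degree_le_natDegree.trans_lt ?_
    rw [Nat.cast_lt]
    have h1 : (w i).natDegree
        ≤ 0 + (i.2.2 : ℕ) * ℓ + (i.2.1 : ℕ) * 1 + ((e - 1 - i.1 : ℕ) * b) * r := by
      refine natDegree_mul_le.trans (add_le_add (natDegree_mul_le.trans (add_le_add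
        (natDegree_mul_le.trans (add_le_add (natDegree_C _).le ?_)) ?_)) ?_)
      · exact natDegree_X_pow_le _
      · exact natDegree_pow_le.trans (by rw [hT, natDegree_X_sub_C])
      · exact natDegree_pow_le
    have h2 : (i.2.2 : ℕ) * ℓ ≤ A * ℓ := Nat.mul_le_mul_right _ i.2.2.2.le
    have h3 : (e - 1 - i.1 : ℕ) * b ≤ ℓ := by
      rw [hb]; exact (Nat.mul_le_mul_right b (by omega)).trans (Nat.le_succ _)
    have h4 := Nat.mul_le_mul_right r h3
    have h5 := i.2.1.2
    rw [hDdef]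
    linarith
  have hdep : ∃ β : Fin e × Fin J × Fin A → K, ∑ i, β i • w i = 0 ∧ ∃ i, β i ≠ 0 := by
    let v : Fin e × Fin J × Fin A → degreeLT K D := fun i => ⟨w i, hw i⟩
    have hv : ¬ LinearIndependent K v := by
      intro h
      have := h.fintype_card_le_finrank
      rw [(degreeLTEquiv K D).finrank_eq] at this
      simp only [Fintype.card_prod, Fintype.card_fin, Module.finrank_fintype_fun_eq_card] at this
      rw [← mul_assoc] at this
      omega
    obtain ⟨β, h1, h2⟩ := Fintype.not_linearIndependent_iff.mp hv
    refine ⟨β, ?_, h2⟩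
    simpa [v] using congrArg Subtype.val h1
  obtain ⟨β, hβ, i₀, hi₀⟩ := hdep
  let a : Fin J → Fin e → K[X] := fun j i => ∑ k : Fin A, C (β (i, j, k) ^ ℓ) * X ^ (k : ℕ)
  have ha : ∀ j i, (a j i).natDegree ≤ A := fun j i =>
    natDegree_sum_le_of_forall_le _ _ fun k _ => (natDegree_C_mul_X_pow_le _ _).trans k.2.le
  let v : Fin J → K[X] := fun j => ∑ i, a j i * (g ^ b) ^ (i : ℕ)
  have hva : ∀ j, T ^ ℓ ∣ v j → a j = 0 := fun j h =>
    eq_zero_of_X_sub_C_pow_dvd_sum he hb hg hx₀ (ha j)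
      (by rw [← hℓ, hb]; exact Nat.lt_succ_of_le (Nat.mul_le_mul_left _ hA)) h
  let ψ : K[X] := ∑ j : Fin J, (T ^ ℓ) ^ (j : ℕ) * v j
  have hψ : ψ ≠ 0 := by
    intro h
    have h1 := eq_zero_of_sum_pow_mul_eq_zero (pow_ne_zero _ (X_sub_C_ne_zero x₀)) v
      (fun j hj => by simp [v, hva j hj]) h i₀.2.1
    have h2 := congrFun (hva i₀.2.1 (by rw [h1]; exact dvd_zero _)) i₀.1
    have h3 := congrArg (fun q => q.coeff (i₀.2.2 : ℕ)) h2
    simp only [a, finsetSum_coeff, coeff_C_mul, coeff_X_pow, Pi.zero_apply, coeff_zero] at h3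
    rw [Finset.sum_eq_single i₀.2.2] at h3
    · simp [hi₀] at h3
    · intro j _ hj
      have : (i₀.2.2 : ℕ) ≠ j := fun h => hj (Fin.ext h.symm)
      simp [this]
    · simp
  have hdeg : ψ.natDegree ≤ ℓ * J + A + ℓ * r := by
    refine natDegree_sum_le_of_forall_le _ _ fun j _ => natDegree_mul_le.trans ?_
    have h1 : ((T ^ ℓ) ^ (j : ℕ)).natDegree ≤ ℓ * J := by
      rw [← pow_mul]
      refine natDegree_pow_le.trans ?_
      rw [hT, natDegree_X_sub_C, mul_one]
      exact Nat.mul_le_mul_left _ j.2.le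
    have h2 : (v j).natDegree ≤ A + ℓ * r := by
      refine natDegree_sum_le_of_forall_le _ _ fun i _ => natDegree_mul_le.trans
        (add_le_add (ha j i) ?_)
      rw [← pow_mul]
      refine natDegree_pow_le.trans (Nat.mul_le_mul_right _ ?_)
      rw [mul_comm]
      exact hebℓ i
    omega
  have hfrob : ∀ x : K, (x ^ ℓ) ^ ℓ = x := fun x => by
    rw [← pow_mul, ← pow_two, ← hK, FiniteField.pow_card]
  have hroot : ∀ x : K, g.eval x ≠ 0 → g.eval x ^ (b * (ℓ + 1)) = ζ → ψ.eval x = 0 := by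
    intro x hx hζ
    have h1 : g.eval x ^ ((e - 1) * b) * ψ.eval x ^ ℓ = (∑ i, β i • w i).eval x := by
      simp only [ψ, v, a, eval_finsetSum, eval_mul, eval_pow, eval_C, eval_X, hℓ,
        sum_pow_char_pow, w,
        eval_smul, mul_pow, Fintype.sum_prod_type, Finset.mul_sum, Finset.sum_mul, smul_eq_mul]
      rw [Finset.sum_comm]
      refine Finset.sum_congr rfl fun i _ => Finset.sum_congr rfl fun j _ =>
        Finset.sum_congr rfl fun k _ => ?_
      rw [← hℓ, hfrob, ← hζ]
      have h2 : ((T.eval x ^ ℓ) ^ (j : ℕ)) ^ ℓ = T.eval x ^ (j : ℕ) := by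
        rw [← pow_mul, mul_comm, pow_mul, hfrob]
      have h3 : g.eval x ^ ((e - 1) * b)
          = g.eval x ^ ((e - 1 - i : ℕ) * b) * g.eval x ^ ((i : ℕ) * b) := by
        rw [← pow_add, ← add_mul]
        congr 2
        omega
      rw [h2, h3]
      ring
    rw [hβ, eval_zero] at h1
    exact pow_eq_zero_iff (M₀ := K) (n := ℓ) (by rw [hb]; omega) |>.mp
      ((mul_eq_zero.mp h1).resolve_left (pow_ne_zero _ hx))
  refine (Finset.card_le_card (t := ψ.roots.toFinset) fun x hx => ?_).trans
    ((Multiset.toFinset_card_le _).trans ((card_roots' ψ).trans hdeg))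
  rw [Finset.mem_filter] at hx
  rw [Multiset.mem_toFinset, mem_roots hψ]
  exact hroot x hx.2.1 hx.2.2

lemma card_eval_pow_eq_le_add [Fintype K] [DecidableEq K] {p μ : ℕ} [Fact p.Prime] [CharP K p]
    (hK : Fintype.card K = (p ^ μ) ^ 2) {e b : ℕ} (he : 0 < e) (hb : p ^ μ = e * b + 1) {g : K[X]}
    (hg : ∀ (s : ℕ) (c : K[X]) (γ : K), γ ≠ 0 → c ^ e = C γ * g ^ s → e ∣ s) (ζ : K) :
    Finset.card {x : K | g.eval x ≠ 0 ∧ g.eval x ^ (b * (p ^ μ + 1)) = ζ}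
      ≤ p ^ μ * (b + (e * (2 * g.natDegree + 3) + 3 * g.natDegree + 5)) := by
  set r := g.natDegree with hr
  rcases lt_or_ge b (2 * r + 3) with h | h
  · refine (Finset.card_le_univ _).trans ?_
    rw [hK, pow_two]
    refine Nat.mul_le_mul_left _ ?_
    have := Nat.mul_le_mul_left e h.le
    omega
  rcases em (∃ x₀, g.eval x₀ ≠ 0) with ⟨x₀, hx₀⟩ | hx
  · have hbl : b ≤ p ^ μ := by rw [hb]; nlinarith
    obtain ⟨A, rfl⟩ : ∃ A, b = A + r := ⟨b - r, by omega⟩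
    refine (card_eval_pow_eq_le hK he hb hg hx₀ (A := A) (J := A + r + (2 * r + 4))
      le_rfl ?_ ζ).trans ?_
    · rw [← hr, hb]
      have h1 : 2 * (A + r) + (2 * r + 4) < (A + r) * (r + 4) - r * (2 * r + 4) := by
        rw [Nat.lt_sub_iff_add_lt]
        nlinarith
      zify [show r * (2 * r + 4) ≤ (A + r) * (r + 4) by nlinarith] at h1
      have h2 : (1 : ℤ) ≤ e := by exact_mod_cast he
      zify
      nlinarith
    · rw [← hr]
      have : 0 ≤ p ^ μ * (e * (2 * r + 3)) := Nat.zero_le _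
      linarith
  · push Not at hx
    simp [hx]

lemma sum_nthRootsFinset_eq_zero {e : ℕ} (he : 1 < e) :
    ∑ z ∈ nthRootsFinset e (1 : ℂ), z = 0 := by
  have hω := Complex.isPrimitiveRoot_exp e (by omega)
  set ω := Complex.exp (2 * Real.pi * Complex.I / e)
  have hω0 : ω ≠ 0 := hω.ne_zero (by omega)
  have h1 : ∑ z ∈ nthRootsFinset e (1 : ℂ), z = ∑ z ∈ nthRootsFinset e (1 : ℂ), ω * z := by
    refine Finset.sum_bij (fun z _ => ω⁻¹ * z) ?_ ?_ ?_ ?_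
    · intro z hz
      rw [Polynomial.mem_nthRootsFinset (by omega)] at hz ⊢
      rw [mul_pow, hz, inv_pow, hω.pow_eq_one, inv_one, one_mul]
    · intro a _ b _ h
      exact mul_left_cancel₀ (inv_ne_zero hω0) h
    · intro z hz
      refine ⟨ω * z, ?_, by rw [inv_mul_cancel_left₀ hω0]⟩
      rw [Polynomial.mem_nthRootsFinset (by omega)] at hz ⊢
      rw [mul_pow, hz, hω.pow_eq_one, one_mul]
    · intro z _
      rw [mul_inv_cancel_left₀ hω0]
  rw [← Finset.mul_sum] at h1
  have h2 : (1 - ω) * ∑ z ∈ nthRootsFinset e (1 : ℂ), z = 0 := by linear_combination h1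
  exact (mul_eq_zero.mp h2).resolve_left (sub_ne_zero.mpr (hω.ne_one he).symm)

lemma MulChar.pow_div_orderOf_eq_one [Fintype K] (η : MulChar K ℂ) {t : K} (ht : η t = 1) :
    t ^ ((Fintype.card K - 1) / orderOf η) = 1 := by
  classical
  have ht0 : t ≠ 0 := by
    rintro rfl
    simp at ht
  obtain ⟨γ, hγ⟩ := IsCyclic.exists_generator (α := Kˣ)
  obtain ⟨j, hj⟩ := (mem_powers_iff_mem_zpowers.mpr (hγ (Units.mk0 t ht0)))
  simp only at hj
  have htj : t = (γ : K) ^ j := by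
    rw [← Units.val_pow_eq_pow_val, hj, Units.val_mk0]
  have h1 : η ^ j = 1 := by
    rw [MulChar.eq_iff hγ, MulChar.pow_apply_coe, ← map_pow, ← htj, ht, MulChar.one_apply_coe]
  obtain ⟨i, hi⟩ := orderOf_dvd_of_pow_eq_one h1
  obtain ⟨d, hd⟩ := η.orderOf_dvd_card_sub_one
  have hpos : 0 < orderOf η := η.orderOf_pos
  rw [hd, Nat.mul_div_cancel_left _ hpos, htj, ← pow_mul, hi, mul_right_comm, ← hd, mul_comm,
    mul_comm, pow_mul, FiniteField.pow_card_sub_one_eq_one _ γ.ne_zero, one_pow]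

/-- Stepanov's estimate for character sums over a field with `ℓ ^ 2` elements. -/
lemma norm_sum_mulChar_eval_le [Fintype K] {p μ : ℕ} [Fact p.Prime] [CharP K p]
    (hK : Fintype.card K = (p ^ μ) ^ 2) (η : MulChar K ℂ) {e : ℕ} (hη : orderOf η = e) (he : 1 < e)
    (hel : e ∣ p ^ μ - 1) {g : K[X]} (hg0 : g ≠ 0)
    (hg : ∀ (s : ℕ) (c : K[X]) (γ : K), γ ≠ 0 → c ^ e = C γ * g ^ s → e ∣ s) :
    ‖∑ x, η (g.eval x)‖
      ≤ (p ^ μ) * (e * (e * (2 * g.natDegree + 3) + 3 * g.natDegree + 5) + g.natDegree) := by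
  classical
  obtain ⟨b, hb⟩ := hel
  have hl1 : 1 ≤ p ^ μ := Nat.one_le_pow _ _ (Fact.out : p.Prime).pos
  replace hb : p ^ μ = e * b + 1 := by omega
  set M := e * (2 * g.natDegree + 3) + 3 * g.natDegree + 5 with hM
  set U := p ^ μ * (b + M) with hU
  set R := nthRootsFinset e (1 : ℂ) with hR
  let N : ℂ → Finset K := fun z => {x : K | g.eval x ≠ 0 ∧ η (g.eval x) = z}
  have hexp : b * (p ^ μ + 1) = (Fintype.card K - 1) / orderOf η := by
    have : Fintype.card K - 1 = e * (b * (p ^ μ + 1)) := by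
      rw [hK, Nat.sub_eq_iff_eq_add (Nat.one_le_pow _ _ hl1), hb]
      ring
    rw [this, hη, Nat.mul_div_cancel_left _ (by omega)]
  have hNU : ∀ z, (N z).card ≤ U := by
    intro z
    rcases (N z).eq_empty_or_nonempty with h | ⟨x₀, hx₀⟩
    · simp [h]
    · refine (Finset.card_le_card fun x hx => ?_).trans
        (card_eval_pow_eq_le_add hK (by omega) hb hg (g.eval x₀ ^ (b * (p ^ μ + 1))))
      simp only [N, Finset.mem_filter, Finset.mem_univ, true_and] at hx hx₀ ⊢
      refine ⟨hx.1, ?_⟩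
      have h1 : η (g.eval x / g.eval x₀) = 1 := by
        have h2 : η (g.eval x / g.eval x₀) * η (g.eval x₀) = η (g.eval x) := by
          rw [← map_mul, div_mul_cancel₀ _ hx₀.1]
        have h3 : η (g.eval x₀) ≠ 0 := (hx₀.1.isUnit.map η).ne_zero
        rw [hx.2, hx₀.2] at h2
        rw [hx₀.2] at h3
        exact mul_right_cancel₀ h3 (by rw [h2, one_mul])
      have h2 := η.pow_div_orderOf_eq_one h1
      rw [← hexp, div_pow, div_eq_one_iff_eq (pow_ne_zero _ hx₀.1)] at h2
      exact h2
  have hmaps : ∀ x ∈ ({x : K | g.eval x ≠ 0} : Finset K), η (g.eval x) ∈ R := by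
    intro x hx
    rw [Finset.mem_filter] at hx
    rw [hR, Polynomial.mem_nthRootsFinset (by omega), ← MulChar.pow_apply' _ (by omega), ← hη,
      pow_orderOf_eq_one, MulChar.one_apply hx.2.isUnit]
  have hfiber : ∀ z, ({x ∈ ({x : K | g.eval x ≠ 0} : Finset K) | η (g.eval x) = z}) = N z := by
    intro z
    rw [Finset.filter_filter]
  have hsum : ∑ x, η (g.eval x) = ∑ z ∈ R, (N z).card * z := by
    have h1 : ∑ x, η (g.eval x) = ∑ x with g.eval x ≠ 0, η (g.eval x) := by
      rw [Finset.sum_filter]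
      refine Finset.sum_congr rfl fun x _ => ?_
      split_ifs with h
      · rfl
      · rw [not_not.mp h, MulChar.map_zero]
    rw [h1, ← Finset.sum_fiberwise_of_maps_to hmaps]
    refine Finset.sum_congr rfl fun z _ => ?_
    rw [hfiber, Finset.sum_congr rfl (g := fun _ => z), Finset.sum_const, nsmul_eq_mul]
    intro x hx
    exact (Finset.mem_filter.mp hx).2.2
  have hcard : Fintype.card K ≤ ∑ z ∈ R, (N z).card + g.natDegree := by
    have h1 := Finset.card_eq_sum_card_fiberwise hmaps
    simp only [hfiber] at h1
    rw [← h1, ← Finset.card_univ, ← Finset.card_filter_add_card_filter_not (fun x => g.eval x ≠ 0)]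
    refine Nat.add_le_add_left ?_ _
    refine (Finset.card_le_card (t := g.roots.toFinset) fun x hx => ?_).trans
      ((Multiset.toFinset_card_le _).trans (card_roots' g))
    simpa [hg0] using hx
  have hRcard : R.card ≤ e := by
    rw [hR, (Complex.isPrimitiveRoot_exp e (by omega)).card_nthRootsFinset]
  have hsum' : ∑ x, η (g.eval x) = -∑ z ∈ R, ((U : ℂ) - (N z).card) * z := by
    simp only [sub_mul, Finset.sum_sub_distrib]
    rw [← Finset.mul_sum, hR, sum_nthRootsFinset_eq_zero he, hsum]
    ring
  rw [hsum', norm_neg]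
  have hnorm : ‖∑ z ∈ R, ((U : ℂ) - (N z).card) * z‖ ≤ ∑ z ∈ R, ((U : ℝ) - (N z).card) := by
    refine (norm_sum_le _ _).trans (Finset.sum_le_sum fun z hz => ?_)
    rw [hR, Polynomial.mem_nthRootsFinset (by omega)] at hz
    rw [norm_mul, Complex.norm_eq_one_of_pow_eq_one hz (by omega), mul_one]
    have h1 : ((U : ℂ) - (N z).card) = ((U - (N z).card : ℝ) : ℂ) := by push_cast; rfl
    rw [h1, Complex.norm_real, Real.norm_of_nonneg]
    exact sub_nonneg.mpr (by exact_mod_cast hNU z)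
  refine hnorm.trans ?_
  rw [Finset.sum_sub_distrib, Finset.sum_const, nsmul_eq_mul]
  have h1 : (R.card : ℝ) * U ≤ e * U := by gcongr
  have h2 : ((p : ℝ) ^ μ) ^ 2 ≤ ∑ z ∈ R, ((N z).card : ℝ) + g.natDegree := by
    have := hcard
    rw [hK] at this
    exact_mod_cast this
  have h3 : (U : ℝ) = (p : ℝ) ^ μ * (b + M) := by rw [hU]; push_cast; ring
  have h4 : (p : ℝ) ^ μ = e * b + 1 := by exact_mod_cast hb
  have h5 : (M : ℝ) = e * (2 * g.natDegree + 3) + 3 * g.natDegree + 5 := by rw [hM]; push_cast; ring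
  rw [← h5]
  rw [h3] at h1 ⊢
  have h6 : (0 : ℝ) ≤ g.natDegree := by positivity
  have h7 : (1 : ℝ) ≤ (p : ℝ) ^ μ := by exact_mod_cast hl1
  have h8 : (e : ℝ) * ((p : ℝ) ^ μ * (b + M))
      = (p : ℝ) ^ μ * ((p : ℝ) ^ μ - 1) + (p : ℝ) ^ μ * (e * M) := by
    rw [h4]; ring
  nlinarith

end Stepanov

section Resultant

lemma norm_aeval_gen_eq_resultant {F K : Type*} [Field F] [Field K] [Algebra F K]
    [FiniteDimensional F K] [Algebra.IsSeparable F K] (c : K) (g : F[X]) :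
    Algebra.norm F (aeval (IntermediateField.AdjoinSimple.gen F c) g)
      = resultant (minpoly F c) g := by
  classical
  have hc : IsIntegral F c := Algebra.IsIntegral.isIntegral c
  let Ω := AlgebraicClosure F
  apply (algebraMap F Ω).injective
  let pb := IntermediateField.adjoin.powerBasis hc
  have hgen : pb.gen = IntermediateField.AdjoinSimple.gen F c :=
    IntermediateField.adjoin.powerBasis_gen hc
  have hmin : minpoly F pb.gen = minpoly F c := by
    rw [hgen, IntermediateField.minpoly_gen]
  rw [← resultant_map_map, ← natDegree_map (algebraMap F Ω) (p := minpoly F c),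
    resultant_eq_prod_eval _ _ _ (natDegree_map _).le (IsAlgClosed.splits _),
    ((minpoly.monic hc).map _).leadingCoeff, one_pow, one_mul,
    Algebra.norm_eq_prod_embeddings F Ω, ← hgen, ← hmin]
  rw [@Fintype.prod_equiv (IntermediateField.adjoin F {c} →ₐ[F] Ω) _ _ _ _ _ pb.liftEquiv'
    (fun σ => σ (aeval pb.gen g)) (fun x => (g.map (algebraMap F Ω)).eval (x : Ω)) ?_]
  · rw [Finset.prod_mem_multiset _ _ (fun x => (g.map (algebraMap F Ω)).eval x),
      Finset.prod_eq_multiset_prod, Multiset.toFinset_val, Multiset.dedup_eq_self.mpr]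
    · exact nodup_roots (.map (Algebra.IsSeparable.isSeparable F pb.gen))
    · intro x; rfl
  · intro σ
    rw [PowerBasis.liftEquiv'_apply_coe, eval_map_algebraMap, aeval_algHom_apply]

lemma norm_aeval_eq_resultant_pow {F K : Type*} [Field F] [Field K] [Algebra F K]
    [FiniteDimensional F K] [Algebra.IsSeparable F K] (c : K) (g : F[X]) :
    Algebra.norm F (aeval c g)
      = resultant (minpoly F c) g ^ (Module.finrank F K / (minpoly F c).natDegree) := by
  have hc : IsIntegral F c := Algebra.IsIntegral.isIntegral c
  have h1 : aeval c g = algebraMap (IntermediateField.adjoin F {c}) K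
      (aeval (IntermediateField.AdjoinSimple.gen F c) g) := by
    rw [← aeval_algebraMap_apply, IntermediateField.AdjoinSimple.algebraMap_gen]
  rw [h1, ← Algebra.norm_norm (S := IntermediateField.adjoin F {c}), Algebra.norm_algebraMap,
    map_pow, norm_aeval_gen_eq_resultant]
  congr 1
  rw [← Module.finrank_mul_finrank F (IntermediateField.adjoin F {c}) K,
    IntermediateField.adjoin.finrank hc, Nat.mul_div_cancel_left _ (minpoly.natDegree_pos hc)]

variable {F ι : Type*} [Field F] [Fintype ι]

/-- The multiplicative function `h ↦ ∏ᵢ χᵢ(Res(fᵢ, h))`. -/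
noncomputable def resultantChar (χ : ι → MulChar F ℂ) (f : ι → F[X]) (h : F[X]) : ℂ :=
  ∏ i, χ i (resultant (f i) h)

lemma resultantChar_one (χ : ι → MulChar F ℂ) {f : ι → F[X]} :
    resultantChar χ f 1 = 1 := by
  simp [resultantChar]

lemma resultantChar_mul (χ : ι → MulChar F ℂ) (f : ι → F[X]) {a b : F[X]} (ha : a.Monic)
    (hb : b.Monic) :
    resultantChar χ f (a * b) = resultantChar χ f a * resultantChar χ f b := by
  simp only [resultantChar, ← Finset.prod_mul_distrib]
  refine Finset.prod_congr rfl fun i _ => ?_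
  rw [ha.natDegree_mul hb, resultant_mul_right _ _ _ _ le_rfl, map_mul]

lemma resultant_eq_of_dvd_sub {R : Type*} [CommRing R] {f a b : R[X]} (hf : f.Monic)
    (h : f ∣ a - b) : resultant f a = resultant f b := by
  obtain ⟨p, hp⟩ := h
  have ha : a = b + f * p := by rw [← hp]; ring
  set N := a.natDegree + b.natDegree + (p.natDegree + f.natDegree) with hN
  have h1 := resultant_add_mul_right f b p f.natDegree N (by omega) le_rfl
  rw [← ha] at h1
  have h2 : ∀ g : R[X], g.natDegree ≤ N → resultant f g f.natDegree N = resultant f g := by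
    intro g hg
    obtain ⟨k, hk⟩ := Nat.exists_eq_add_of_le hg
    rw [hk, resultant_add_right_deg _ _ _ _ _ le_rfl, coeff_natDegree, hf.leadingCoeff, one_pow,
      one_mul]
  rwa [h2 a (by omega), h2 b (by omega)] at h1

lemma resultantChar_eq_of_dvd_sub (χ : ι → MulChar F ℂ) {f : ι → F[X]} (hf : ∀ i, (f i).Monic)
    {a b : F[X]} (h : ∏ i, f i ∣ a - b) : resultantChar χ f a = resultantChar χ f b := by
  refine Finset.prod_congr rfl fun i _ => ?_
  rw [resultant_eq_of_dvd_sub (hf i) ((Finset.dvd_prod_of_mem f (Finset.mem_univ i)).trans h)]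

variable {K : Type*} [Finite F] [Field K] [Fintype K] [Algebra F K]

lemma card_minpoly_eq [DecidableEq F[X]] {P : F[X]} (hP : P.Monic) (hi : Irreducible P)
    (hdvd : P.natDegree ∣ Module.finrank F K) :
    Finset.card {c : K | minpoly F c = P} = P.natDegree := by
  classical
  have hsplit : (P.map (algebraMap F K)).Splits := by
    have h1 := map_dvd (mapRingHom (algebraMap F K))
      (hi.natDegree_dvd_iff_dvd_X_pow_card_pow_sub_X.mp hdvd)
    have : Nat.card F ^ Module.finrank F K = Nat.card K := Module.natCard_eq_pow_finrank.symm
    rw [this] at h1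
    simp only [coe_mapRingHom, Polynomial.map_sub, Polynomial.map_pow, map_X] at h1
    refine Splits.of_dvd ?_ (FiniteField.X_pow_card_sub_X_ne_zero K Finite.one_lt_card) h1
    rw [splits_iff_card_roots, Nat.card_eq_fintype_card, FiniteField.roots_X_pow_card_sub_X,
      FiniteField.X_pow_card_sub_X_natDegree_eq K Fintype.one_lt_card]
    rfl
  have h1 : ({c : K | minpoly F c = P} : Finset K) = (P.map (algebraMap F K)).roots.toFinset := by
    ext c
    rw [Finset.mem_filter, Multiset.mem_toFinset, mem_roots (hP.map _).ne_zero, IsRoot.def,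
      eval_map_algebraMap]
    constructor
    · rintro ⟨-, rfl⟩
      exact minpoly.aeval F c
    · intro h
      exact ⟨Finset.mem_univ _, (minpoly.eq_of_irreducible_of_monic hi h hP).symm⟩
  rw [h1, Multiset.toFinset_card_of_nodup, ← hsplit.natDegree_eq_card_roots, natDegree_map]
  exact nodup_roots (.map (PerfectField.separable_of_irreducible hi))

lemma lLogCoeff_finrank (Λ : F[X] → ℂ) :
    lLogCoeff Λ (Module.finrank F K)
      = ∑ c : K, Λ (minpoly F c) ^ (Module.finrank F K / (minpoly F c).natDegree) := by
  classical
  have hmaps : ∀ c ∈ (Finset.univ : Finset K), minpoly F c ∈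
      ({P ∈ monicIrreduciblesLE F (Module.finrank F K) | P.natDegree ∣ Module.finrank F K} :
        Finset F[X]) := by
    intro c _
    have hc : IsIntegral F c := Algebra.IsIntegral.isIntegral c
    rw [Finset.mem_filter, mem_monicIrreduciblesLE]
    exact ⟨⟨minpoly.monic hc, minpoly.irreducible hc, minpoly.natDegree_le c⟩,
      minpoly.degree_dvd hc⟩
  rw [← Finset.sum_fiberwise_of_maps_to hmaps, lLogCoeff]
  refine Finset.sum_congr rfl fun P hP => ?_
  rw [Finset.mem_filter, mem_monicIrreduciblesLE] at hP
  rw [← card_minpoly_eq (K := K) hP.1.1 hP.1.2.1 hP.2,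
    Finset.sum_congr rfl (g := fun _ => Λ P ^ (Module.finrank F K / P.natDegree)), Finset.sum_const,
    nsmul_eq_mul, card_minpoly_eq (K := K) hP.1.1 hP.1.2.1 hP.2]
  intro c hc
  rw [(Finset.mem_filter.mp hc).2]

lemma resultantChar_pow_minpoly (χ : ι → MulChar F ℂ) (f : ι → F[X]) (c : K) :
    resultantChar χ f (minpoly F c) ^ (Module.finrank F K / (minpoly F c).natDegree)
      = (∏ i, χ i ((-1) ^ ((f i).natDegree * Module.finrank F K)))
        * ∏ i, χ i (Algebra.norm F (aeval c (f i))) := by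
  have hc : IsIntegral F c := Algebra.IsIntegral.isIntegral c
  rw [resultantChar, ← Finset.prod_pow, ← Finset.prod_mul_distrib]
  refine Finset.prod_congr rfl fun i _ => ?_
  rw [← map_mul, ← map_pow, norm_aeval_eq_resultant_pow, resultant_comm, mul_pow, ← pow_mul,
    mul_assoc, Nat.mul_div_cancel' (minpoly.degree_dvd hc)]

lemma MulChar.norm_apply_of_ne_zero (χ : MulChar F ℂ) {a : F} (ha : a ≠ 0) : ‖χ a‖ = 1 := by
  have := Fintype.ofFinite F
  refine Complex.norm_eq_one_of_pow_eq_one (n := Nat.card Fˣ) ?_ Nat.card_pos.ne'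
  lift a to Fˣ using ha.isUnit
  rw [← map_pow, ← Units.val_pow_eq_pow_val, pow_card_eq_one', Units.val_one, map_one]

lemma norm_lLogCoeff_resultantChar (χ : ι → MulChar F ℂ) (f : ι → F[X]) :
    ‖lLogCoeff (resultantChar χ f) (Module.finrank F K)‖
      = ‖∑ c : K, ∏ i, χ i (Algebra.norm F (aeval c (f i)))‖ := by
  rw [lLogCoeff_finrank (K := K)]
  simp only [resultantChar_pow_minpoly]
  rw [← Finset.mul_sum, norm_mul, norm_prod, Finset.prod_eq_one, one_mul]
  intro i _
  exact (χ i).norm_apply_of_ne_zero (pow_ne_zero _ (neg_ne_zero.mpr one_ne_zero))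

end Resultant

instance MulChar.isCyclic {F : Type*} [Field F] [Finite F] : IsCyclic (MulChar F ℂ) := by
  have := Fintype.ofFinite F
  obtain ⟨φ⟩ := MulChar.mulEquiv_units F ℂ
  exact isCyclic_of_surjective φ.symm φ.symm.surjective

lemma MulChar.exists_forall_eq_pow {F ι : Type*} [Field F] [Finite F] [Nonempty ι]
    (χ : ι → MulChar F ℂ) (hχ : ∀ i, χ i ≠ 1) :
    ∃ (ψ : MulChar F ℂ) (k : ι → ℕ), (∀ i, k i ≠ 0) ∧ (∀ i, χ i = ψ ^ k i) ∧ 1 < orderOf ψ ∧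
      ∀ s, (∀ i, χ i ^ s = 1) → orderOf ψ ∣ s := by
  have : Finite (MulChar F ℂ) := inferInstance
  obtain ⟨ψ, hψ⟩ := IsCyclic.exists_monoid_generator (α := Subgroup.closure (Set.range χ))
  have hk : ∀ i, ∃ k : ℕ, (ψ : MulChar F ℂ) ^ k = χ i := by
    intro i
    obtain ⟨k, hk⟩ := hψ ⟨χ i, Subgroup.subset_closure ⟨i, rfl⟩⟩
    exact ⟨k, by simpa using congrArg Subtype.val hk⟩
  choose k hk using hk
  have hk0 : ∀ i, k i ≠ 0 := by
    intro i h0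
    apply hχ i
    rw [← hk, h0, pow_zero]
  refine ⟨ψ, k, hk0, fun i => (hk i).symm, ?_, ?_⟩
  · have h0 := orderOf_pos (ψ : MulChar F ℂ)
    have h1 : orderOf (ψ : MulChar F ℂ) ≠ 1 := by
      intro h1
      obtain ⟨i⟩ := ‹Nonempty ι›
      apply hχ i
      rw [← hk, orderOf_eq_one_iff.mp h1, one_pow]
    omega
  · intro s hs
    rw [orderOf_dvd_iff_pow_eq_one]
    have hle : Subgroup.closure (Set.range χ) ≤ (powMonoidHom s : MulChar F ℂ →* _).ker := by
      rw [Subgroup.closure_le]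
      rintro _ ⟨i, rfl⟩
      exact hs i
    exact hle ψ.2

/-- The pullback of a multiplicative character along the norm of a finite extension. -/
noncomputable def MulChar.compNorm {F : Type*} [Field F] (χ : MulChar F ℂ) (K : Type*) [Field K]
    [Algebra F K] [FiniteDimensional F K] : MulChar K ℂ where
  toMonoidHom := χ.toMonoidHom.comp (Algebra.norm F)
  map_nonunit' a ha := by
    have : a = 0 := by simpa using ha
    simp [this]

section Norm

variable {F : Type*} [Field F] {K : Type*} [Field K] [Algebra F K] [FiniteDimensional F K]

lemma MulChar.compNorm_apply (χ : MulChar F ℂ) (a : K) :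
    χ.compNorm K a = χ (Algebra.norm F a) := rfl

lemma MulChar.orderOf_compNorm [Finite F] [Finite K] (χ : MulChar F ℂ) :
    orderOf (χ.compNorm K) = orderOf χ := by
  rw [orderOf_eq_orderOf_iff]
  intro n
  simp only [MulChar.eq_one_iff, MulChar.pow_apply_coe, MulChar.compNorm_apply]
  constructor
  · intro h a
    obtain ⟨b, hb⟩ := FiniteField.norm_surjective F K (a : F)
    have hb0 : b ≠ 0 := by
      rintro rfl
      exact a.ne_zero (by rw [← hb, Algebra.norm_zero])
    simpa [hb] using h (Units.mk0 b hb0)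
  · intro h a
    exact h (Units.mk0 _ (Algebra.norm_ne_zero_iff.mpr a.ne_zero))

end Norm

lemma dvd_mul_of_pow_eq_C_mul_prod_pow {K ι : Type*} [Field K] [Fintype ι] {f : ι → K[X]}
    (hdeg : ∀ i, (f i).natDegree ≠ 0) (hsep : (∏ i, f i).Separable) {k : ι → ℕ} {e s : ℕ}
    {c : K[X]} {γ : K} (hγ : γ ≠ 0) (h : c ^ e = C γ * (∏ i, f i ^ k i) ^ s) (i : ι) :
    e ∣ k i * s := by
  classical
  obtain ⟨P, hP, w, hw⟩ := exists_irreducible_of_natDegree_ne_zero (hdeg i)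
  have hp : Prime P := hP.prime
  have hsq := hsep.squarefree
  have hone : ∀ x, P * P * x ≠ ∏ j, f j := fun x hx => hP.not_isUnit (hsq P ⟨x, hx.symm⟩)
  have hmul : ∀ (a : ℕ) (t : K[X]), ¬ P ∣ t → emultiplicity P (P ^ a * t) = a := by
    intro a t ht
    rw [emultiplicity_mul hp, emultiplicity_pow_self hp.ne_zero hp.not_isUnit,
      emultiplicity_eq_zero.mpr ht, add_zero]
  have hPw : ¬ P ∣ w := by
    rintro ⟨v, rfl⟩
    apply hone (v * ∏ j ∈ Finset.univ.erase i, f j)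
    rw [← Finset.mul_prod_erase _ _ (Finset.mem_univ i), hw]
    ring
  have hPj : ¬ P ∣ ∏ j ∈ Finset.univ.erase i, f j ^ k j := by
    rw [hp.dvd_finsetProd_iff]
    rintro ⟨j, hj, hd⟩
    obtain ⟨v, hv⟩ := (hp.dvd_of_dvd_pow hd).trans (Finset.dvd_prod_of_mem f hj)
    apply hone (w * v)
    rw [← Finset.mul_prod_erase _ _ (Finset.mem_univ i), hw, hv]
    ring
  have hc0 : e ≠ 0 → c ≠ 0 := by
    rintro he rfl
    rw [zero_pow he, eq_comm, mul_eq_zero, C_eq_zero, or_iff_right hγ] at h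
    refine pow_ne_zero s (Finset.prod_ne_zero_iff.mpr fun j _ => pow_ne_zero _ ?_) h
    exact ne_zero_of_natDegree_gt (Nat.pos_of_ne_zero (hdeg j))
  have hr : C γ * (∏ j, f j ^ k j) ^ s
      = P ^ (k i * s) * (C γ * w ^ (k i * s) * (∏ j ∈ Finset.univ.erase i, f j ^ k j) ^ s) := by
    rw [← Finset.mul_prod_erase _ _ (Finset.mem_univ i), hw]
    ring
  have hnd : ¬ P ∣ C γ * w ^ (k i * s) * (∏ j ∈ Finset.univ.erase i, f j ^ k j) ^ s := by
    intro hd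
    rcases hp.dvd_or_dvd hd with hd | hd
    · rcases hp.dvd_or_dvd hd with hd | hd
      · exact hp.not_isUnit (isUnit_of_dvd_unit hd (isUnit_C.mpr hγ.isUnit))
      · exact hPw (hp.dvd_of_dvd_pow hd)
    · exact hPj (hp.dvd_of_dvd_pow hd)
  have hE := hmul (k i * s) _ hnd
  rw [← hr, ← h, emultiplicity_pow hp] at hE
  rcases eq_or_ne e 0 with rfl | he
  · have h0 : k i * s = 0 := by simpa using hE.symm
    simp [h0]
  · have hfin : FiniteMultiplicity P c := FiniteMultiplicity.of_prime_left hp (hc0 he)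
    rw [hfin.emultiplicity_eq_multiplicity] at hE
    exact ⟨multiplicity P c, by exact_mod_cast hE.symm⟩

lemma norm_sum_prod_mulChar_norm_le {F ι K : Type*} [Field F] [Finite F] [Fintype ι]
    [Field K] [Fintype K] [Algebra F K] {f : ι → F[X]}
    (hdeg : ∀ i, (f i).natDegree ≠ 0) (hsep : (∏ i, f i).Separable)
    {χ : ι → MulChar F ℂ} {ψ : MulChar F ℂ} {k : ι → ℕ} (hk0 : ∀ i, k i ≠ 0)
    (hk : ∀ i, χ i = ψ ^ k i) (hψ : 1 < orderOf ψ)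
    (hs : ∀ s, (∀ i, χ i ^ s = 1) → orderOf ψ ∣ s) (heven : Even (Module.finrank F K)) :
    ‖∑ c : K, ∏ i, χ i (Algebra.norm F (aeval c (f i)))‖
      ≤ (orderOf ψ * (orderOf ψ * (2 * (∏ i, f i ^ k i).natDegree + 3)
          + 3 * (∏ i, f i ^ k i).natDegree + 5) + (∏ i, f i ^ k i).natDegree)
        * √(Nat.card F) ^ Module.finrank F K := by
  have := Fintype.ofFinite F
  obtain ⟨m, hm⟩ := heven
  rw [← two_mul] at hm
  obtain ⟨p, _⟩ := CharP.exists F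
  obtain ⟨a, hp, ha⟩ := FiniteField.card F p
  have : Fact p.Prime := ⟨hp⟩
  have : CharP K p := charP_of_injective_algebraMap (algebraMap F K).injective p
  have hcardK : Fintype.card K = (p ^ ((a : ℕ) * m)) ^ 2 := by
    rw [Module.card_eq_pow_finrank (K := F), ha, hm]
    ring
  have hel : orderOf (ψ.compNorm K) ∣ p ^ ((a : ℕ) * m) - 1 := by
    rw [MulChar.orderOf_compNorm, pow_mul, ← ha]
    refine (MulChar.orderOf_dvd_card_sub_one F ψ).trans ?_
    simpa using Nat.sub_dvd_pow_sub_pow (Fintype.card F) 1 m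
  set g := ∏ i, f i ^ k i with hg
  have hf0 : ∀ i, f i ≠ 0 := fun i => ne_zero_of_natDegree_gt (Nat.pos_of_ne_zero (hdeg i))
  have hg0 : g ≠ 0 := Finset.prod_ne_zero_iff.mpr fun i _ => pow_ne_zero _ (hf0 i)
  have hmapg : g.map (algebraMap F K) = ∏ i, (f i).map (algebraMap F K) ^ k i := by
    rw [hg, Polynomial.map_prod]
    simp only [Polynomial.map_pow]
  have key := norm_sum_mulChar_eval_le hcardK (ψ.compNorm K) rfl
    (by rwa [MulChar.orderOf_compNorm]) hel (g := g.map (algebraMap F K))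
    ((Polynomial.map_ne_zero_iff (algebraMap F K).injective).mpr hg0) ?_
  · have hterm : ∀ c : K, ∏ i, χ i (Algebra.norm F (aeval c (f i)))
        = ψ.compNorm K ((g.map (algebraMap F K)).eval c) := by
      intro c
      rw [hmapg, eval_prod, MulChar.compNorm_apply, map_prod, map_prod]
      refine Finset.prod_congr rfl fun i _ => ?_
      rw [eval_pow, map_pow, map_pow, hk, MulChar.pow_apply' _ (hk0 i), eval_map_algebraMap]
    have hq : √(Nat.card F : ℝ) ^ Module.finrank F K = (p : ℝ) ^ ((a : ℕ) * m) := by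
      rw [hm, pow_mul, Real.sq_sqrt (Nat.cast_nonneg _), Nat.card_eq_fintype_card, ha]
      push_cast
      ring
    rw [hq, Finset.sum_congr rfl fun c _ => hterm c]
    rw [MulChar.orderOf_compNorm, natDegree_map] at key
    linarith
  · intro s c γ hγ h
    rw [MulChar.orderOf_compNorm]
    apply hs
    intro i
    rw [hk, ← pow_mul, ← orderOf_dvd_iff_pow_eq_one]
    rw [MulChar.orderOf_compNorm, hmapg] at h
    refine dvd_mul_of_pow_eq_C_mul_prod_pow (fun i => by rw [natDegree_map]; exact hdeg i) ?_ hγ h i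
    rw [← Polynomial.map_prod]
    exact hsep.map

section Weil

lemma FiniteField.exists_extension (F : Type*) [Field F] [Finite F] {n : ℕ} (hn : n ≠ 0) :
    ∃ (K : Type) (_ : Field K) (_ : Fintype K) (_ : Algebra F K), Module.finrank F K = n := by
  obtain ⟨p, _⟩ := CharP.exists F
  have : Fact p.Prime := ⟨CharP.char_is_prime F p⟩
  have : NeZero n := ⟨hn⟩
  have : Finite (FiniteField.Extension F p n) := Module.finite_of_finite F
  exact ⟨FiniteField.Extension F p n, inferInstance, Fintype.ofFinite _, inferInstance,
    FiniteField.finrank_extension F p n⟩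

variable {F ι : Type*} [Field F] [Finite F] [Fintype ι] {f : ι → F[X]} {χ : ι → MulChar F ℂ}

lemma MulChar.norm_apply_le_one (χ : MulChar F ℂ) (a : F) : ‖χ a‖ ≤ 1 := by
  rcases eq_or_ne a 0 with rfl | ha
  · simp
  · exact (χ.norm_apply_of_ne_zero ha).le

lemma norm_resultantChar_le_one (χ : ι → MulChar F ℂ) (f : ι → F[X]) (h : F[X]) :
    ‖resultantChar χ f h‖ ≤ 1 := by
  rw [resultantChar, norm_prod]
  exact Finset.prod_le_one (fun _ _ => norm_nonneg _) fun i _ => (χ i).norm_apply_le_one _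

lemma exists_norm_lLogCoeff_resultantChar_le [Nonempty ι] (hdeg : ∀ i, (f i).natDegree ≠ 0)
    (hsep : (∏ i, f i).Separable) (hχ : ∀ i, χ i ≠ 1) :
    ∃ C : ℝ, ∀ n, Even n →
      ‖lLogCoeff (resultantChar χ f) n‖ ≤ C * √(Nat.card F) ^ n := by
  obtain ⟨ψ, k, hk0, hk, hψ, hs⟩ := MulChar.exists_forall_eq_pow χ hχ
  refine ⟨orderOf ψ * (orderOf ψ * (2 * (∏ i, f i ^ k i).natDegree + 3)
    + 3 * (∏ i, f i ^ k i).natDegree + 5) + (∏ i, f i ^ k i).natDegree, fun n hn => ?_⟩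
  · rcases eq_or_ne n 0 with rfl | hn0
    · have h0 : lLogCoeff (resultantChar χ f) 0 = 0 := by
        refine Finset.sum_eq_zero fun P hP => ?_
        rw [Finset.mem_filter, mem_monicIrreduciblesLE] at hP
        rw [Nat.le_zero.mp hP.1.2.2, Nat.cast_zero, zero_mul]
      rw [h0, norm_zero, pow_zero, mul_one]
      positivity
    · obtain ⟨K, _, _, _, hK⟩ := FiniteField.exists_extension F hn0
      subst hK
      rw [norm_lLogCoeff_resultantChar]
      exact norm_sum_prod_mulChar_norm_le hdeg hsep hk0 hk hψ hs hn

lemma exists_resultantChar_ne_one [Nonempty ι] (hdeg : ∀ i, (f i).natDegree ≠ 0)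
    (hsep : (∏ i, f i).Separable) (hχ : ∀ i, χ i ≠ 1) :
    ∃ u : F[X], u.Monic ∧ IsCoprime (∏ i, f i) u ∧ resultantChar χ f u ≠ 1 := by
  classical
  by_contra! h
  obtain ⟨C, hC⟩ := exists_norm_lLogCoeff_resultantChar_le hdeg hsep hχ
  set G := ∏ i, f i with hG
  have hG0 : G ≠ 0 := hsep.ne_zero
  have hq : (1 : ℝ) < Nat.card F := by exact_mod_cast Finite.one_lt_card (α := F)
  obtain ⟨m, hm⟩ := pow_unbounded_of_one_lt (C + 2 * G.natDegree) hq
  obtain ⟨K, _, _, _, hK⟩ := FiniteField.exists_extension F (n := 2 * (m + 1)) (by omega)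
  have hterm : ∀ c : K, ‖1 - resultantChar χ f (minpoly F c) ^
      (Module.finrank F K / (minpoly F c).natDegree)‖
        ≤ if c ∈ (G.map (algebraMap F K)).roots.toFinset then 2 else 0 := by
    intro c
    have hc : IsIntegral F c := Algebra.IsIntegral.isIntegral c
    have hmem : c ∈ (G.map (algebraMap F K)).roots.toFinset ↔ aeval c G = 0 := by
      rw [Multiset.mem_toFinset, mem_roots ((Polynomial.map_ne_zero_iff
        (algebraMap F K).injective).mpr hG0), IsRoot.def, eval_map_algebraMap]
    split_ifs with h0
    · refine (norm_sub_le _ _).trans ?_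
      rw [norm_one, norm_pow]
      linarith [pow_le_one₀ (n := Module.finrank F K / (minpoly F c).natDegree) (norm_nonneg _)
        (norm_resultantChar_le_one χ f (minpoly F c))]
    · rw [h _ (minpoly.monic hc), one_pow, sub_self, norm_zero]
      rw [isCoprime_comm, (minpoly.irreducible hc).coprime_iff_not_dvd]
      exact fun hd => h0 (hmem.mpr (minpoly.dvd_iff.mp hd))
  have hsum : (Nat.card F : ℝ) ^ (2 * (m + 1))
      ≤ C * √(Nat.card F) ^ (2 * (m + 1)) + G.natDegree * 2 := by
    have h1 : ‖∑ c : K, (1 - resultantChar χ f (minpoly F c) ^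
        (Module.finrank F K / (minpoly F c).natDegree))‖ ≤ G.natDegree * 2 := by
      refine (norm_sum_le_of_le _ fun c _ => hterm c).trans ?_
      rw [← Finset.sum_filter, Finset.sum_const, nsmul_eq_mul]
      refine mul_le_mul_of_nonneg_right ?_ zero_le_two
      rw [Finset.filter_mem_eq_inter, Finset.univ_inter]
      exact_mod_cast (Multiset.toFinset_card_le _).trans
        ((card_roots' _).trans natDegree_map_le)
    rw [Finset.sum_sub_distrib, ← lLogCoeff_finrank, Finset.sum_const, Finset.card_univ,
      ← Nat.card_eq_fintype_card, Module.natCard_eq_pow_finrank (K := F), hK, nsmul_one] at h1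
    have h2 := hC (2 * (m + 1)) (even_two_mul _)
    have h3 := norm_sub_norm_le ((Nat.card F ^ (2 * (m + 1)) : ℕ) : ℂ)
      (lLogCoeff (resultantChar χ f) (2 * (m + 1)))
    rw [Complex.norm_natCast] at h3
    push_cast at h1 h3
    linarith
  rw [pow_mul √(Nat.card F : ℝ), Real.sq_sqrt (Nat.cast_nonneg _), mul_comm 2, pow_mul] at hsum
  have h1 : (1 : ℝ) ≤ Nat.card F ^ (m + 1) := one_le_pow₀ hq.le
  have h2 : (Nat.card F : ℝ) ^ m ≤ Nat.card F ^ (m + 1) := pow_le_pow_right₀ hq.le (Nat.le_succ m)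
  have h3 : (0 : ℝ) ≤ G.natDegree := Nat.cast_nonneg _
  nlinarith

end Weil

section CharacterSum

variable {F ι : Type*} [Field F] [Fintype F] [Fintype ι] [Nonempty ι] {f : ι → F[X]}
  {χ : ι → MulChar F ℂ}

lemma norm_sum_prod_mulChar_eval_le_of_monic (hf : ∀ i, (f i).Monic)
    (hdeg : ∀ i, (f i).natDegree ≠ 0) (hsep : (∏ i, f i).Separable) (hχ : ∀ i, χ i ≠ 1) :
    ‖∑ c, ∏ i, χ i ((f i).eval c)‖ ≤ (∑ i, (f i).natDegree : ℕ) * √(Fintype.card F) := by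
  classical
  obtain ⟨u, hu, hu1, hu2⟩ := exists_resultantChar_ne_one hdeg hsep hχ
  obtain ⟨B, hB⟩ := exists_norm_lLogCoeff_resultantChar_le hdeg hsep hχ
  have hq : (0 : ℝ) < Nat.card F := by exact_mod_cast Nat.card_pos
  have key := norm_lCoeff_one_le (resultantChar_one χ)
    (fun a b ha hb => resultantChar_mul χ f ha hb) (monic_prod_of_monic _ _ fun i _ => hf i)
    (fun a b _ _ h => resultantChar_eq_of_dvd_sub χ hf h) hu hu1 hu2 (Real.sqrt_pos.mpr hq) hB
  rw [natDegree_prod_of_monic _ _ fun i _ => hf i, Nat.card_eq_fintype_card] at key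
  convert key using 1
  have himage : monicsOfDegree F 1 = Finset.univ.image fun c : F => X - C c := by
    ext h
    rw [mem_monicsOfDegree, Finset.mem_image]
    constructor
    · rintro ⟨h1, h2⟩
      refine ⟨-h.coeff 0, Finset.mem_univ _, ?_⟩
      rw [h1.eq_X_add_C h2]
      simp
    · rintro ⟨c, -, rfl⟩
      exact ⟨monic_X_sub_C c, natDegree_X_sub_C c⟩
  have hterm : ∀ c : F, resultantChar χ f (X - C c)
      = (∏ i, χ i ((-1) ^ (f i).natDegree)) * ∏ i, χ i ((f i).eval c) := by
    intro c
    rw [resultantChar, ← Finset.prod_mul_distrib]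
    refine Finset.prod_congr rfl fun i _ => ?_
    rw [natDegree_X_sub_C, resultant_X_sub_C_right _ _ _ le_rfl, map_mul]
  rw [lCoeff, himage, Finset.sum_image fun a _ b _ h => by simpa using h,
    Finset.sum_congr rfl fun c _ => hterm c, ← Finset.mul_sum, norm_mul, norm_prod,
    Finset.prod_eq_one (fun i _ => (χ i).norm_apply_of_ne_zero
      (pow_ne_zero _ (neg_ne_zero.mpr one_ne_zero))), one_mul]

/-- Weil's bound for products of nontrivial multiplicative characters of polynomials with
separable product. -/
theorem norm_sum_prod_mulChar_eval_mul_le (hdeg : ∀ i, (f i).natDegree ≠ 0)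
    (hsep : (∏ i, f i).Separable) (hχ : ∀ i, χ i ≠ 1) {ε : ι → F} (hε : ∀ i, ε i ≠ 0) :
    ‖∑ c, ∏ i, χ i ((f i).eval c * ε i)‖ ≤ (∑ i, (f i).natDegree : ℕ) * √(Fintype.card F) := by
  have hlead : ∀ i, (f i).leadingCoeff ≠ 0 := fun i =>
    leadingCoeff_ne_zero.mpr (ne_zero_of_natDegree_gt (Nat.pos_of_ne_zero (hdeg i)))
  have hmonic : ∀ i, (f i * C (f i).leadingCoeff⁻¹).Monic := fun i =>
    monic_mul_leadingCoeff_inv (leadingCoeff_ne_zero.mp (hlead i))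
  have hnat : ∀ i, (f i * C (f i).leadingCoeff⁻¹).natDegree = (f i).natDegree := fun i =>
    natDegree_mul_C (inv_ne_zero (hlead i))
  have key := norm_sum_prod_mulChar_eval_le_of_monic hmonic (fun i => (hnat i).trans_ne (hdeg i))
    ?_ hχ
  · simp only [hnat] at key
    have hterm : ∀ c : F, ∏ i, χ i ((f i).eval c * ε i) = (∏ i, χ i ((f i).leadingCoeff * ε i)) *
        ∏ i, χ i ((f i * C (f i).leadingCoeff⁻¹).eval c) := by
      intro c
      rw [← Finset.prod_mul_distrib]
      refine Finset.prod_congr rfl fun i _ => ?_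
      have := hlead i
      rw [← map_mul, eval_mul, eval_C]
      congr 1
      field_simp
    rwa [Finset.sum_congr rfl fun c _ => hterm c, ← Finset.mul_sum, norm_mul, norm_prod,
      Finset.prod_eq_one (fun i _ => (χ i).norm_apply_of_ne_zero
        (mul_ne_zero (hlead i) (hε i))), one_mul]
  · rw [Finset.prod_mul_distrib, ← map_prod]
    exact hsep.mul_unit
      (isUnit_C.mpr (Finset.prod_ne_zero_iff.mpr fun i _ => inv_ne_zero (hlead i)).isUnit)

end CharacterSum

section PowerResidues

lemma MulChar.exists_pow_eq_one_and_apply_ne_one {F : Type*} [Field F] [Finite F] {r : ℕ} {u : Fˣ}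
    (hu : ∀ y : Fˣ, y ^ r ≠ u) : ∃ χ : MulChar F ℂ, χ ^ r = 1 ∧ χ u ≠ 1 := by
  let H : Subgroup Fˣ := (powMonoidHom r : Fˣ →* Fˣ).range
  have hmk : (QuotientGroup.mk u : Fˣ ⧸ H) ≠ 1 := by
    rw [Ne, QuotientGroup.eq_one_iff]
    rintro ⟨y, hy⟩
    exact hu y hy
  obtain ⟨φ, hφ⟩ := CommGroup.exists_apply_ne_one_of_hasEnoughRootsOfUnity (Fˣ ⧸ H) ℂ hmk
  refine ⟨MulChar.ofUnitHom (φ.comp (QuotientGroup.mk' H)), ?_, ?_⟩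
  · rw [MulChar.eq_one_iff]
    intro v
    have hv : (QuotientGroup.mk (v ^ r) : Fˣ ⧸ H) = 1 :=
      (QuotientGroup.eq_one_iff _).mpr ⟨v, rfl⟩
    rw [MulChar.pow_apply_coe, MulChar.ofUnitHom_coe, ← Units.val_pow_eq_pow_val, ← map_pow,
      MonoidHom.comp_apply, QuotientGroup.mk'_apply, hv, map_one, Units.val_one]
  · rw [MulChar.ofUnitHom_coe, Ne, Units.val_eq_one]
    exact hφ

open Classical in
/-- The finite set of complex multiplicative characters whose order divides `r`. -/
noncomputable def mulCharsPowEqOne (F : Type*) [Field F] [Finite F] (r : ℕ) :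
    Finset (MulChar F ℂ) :=
  have := Fintype.ofFinite (MulChar F ℂ)
  {χ | χ ^ r = 1}

variable {F : Type*} [Field F]

lemma mem_mulCharsPowEqOne [Finite F] {r : ℕ} {χ : MulChar F ℂ} :
    χ ∈ mulCharsPowEqOne F r ↔ χ ^ r = 1 := by
  simp [mulCharsPowEqOne]

lemma one_mem_mulCharsPowEqOne [Finite F] (r : ℕ) : 1 ∈ mulCharsPowEqOne F r :=
  mem_mulCharsPowEqOne.mpr (one_pow r)

lemma card_mulCharsPowEqOne_le [Finite F] {r : ℕ} (hr : r ≠ 0) :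
    (mulCharsPowEqOne F r).card ≤ r := by
  classical
  have := Fintype.ofFinite (MulChar F ℂ)
  have h : mulCharsPowEqOne F r = ({χ | χ ^ r = 1} : Finset (MulChar F ℂ)) := by
    ext χ
    simp [mem_mulCharsPowEqOne]
  rw [h]
  exact IsCyclic.card_pow_eq_one_le (Nat.pos_of_ne_zero hr)

lemma exists_pow_eq_of_sum_mulChar_ne_zero [Finite F] {r : ℕ} {z : F}
    (h : ∑ χ ∈ mulCharsPowEqOne F r, χ z ≠ 0) : ∃ y : Fˣ, (y : F) ^ r = z := by
  by_contra! hz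
  rcases eq_or_ne z 0 with rfl | hz0
  · exact h (Finset.sum_eq_zero fun χ _ => χ.map_zero)
  lift z to Fˣ using hz0.isUnit
  obtain ⟨χ, hχ, hχz⟩ := MulChar.exists_pow_eq_one_and_apply_ne_one (r := r) (u := z)
    fun y hy => hz y (by rw [← hy, Units.val_pow_eq_pow_val])
  have key : χ z * ∑ ψ ∈ mulCharsPowEqOne F r, ψ z = ∑ ψ ∈ mulCharsPowEqOne F r, ψ z := by
    rw [Finset.mul_sum]
    refine Finset.sum_equiv (Equiv.mulLeft χ) (fun ψ => ?_) fun ψ _ => ?_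
    · rw [mem_mulCharsPowEqOne, mem_mulCharsPowEqOne, Equiv.coe_mulLeft, mul_pow, hχ, one_mul]
    · rfl
  exact hχz (mul_right_cancel₀ h (key.trans (one_mul _).symm))

open Classical in
lemma norm_sum_prod_mulChar_sub_le {ι : Type*} [Fintype F] [Fintype ι] {f : ι → F[X]}
    (hdeg : ∀ i, (f i).natDegree ≠ 0) (hsep : (∏ i, f i).Separable) {ε : ι → F}
    (hε : ∀ i, ε i ≠ 0) (χ : ι → MulChar F ℂ) :
    ‖∑ c, ∏ i, χ i ((f i).eval c * ε i) - if χ = 1 then (Fintype.card F : ℂ) else 0‖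
      ≤ ∑ i, (f i).natDegree * if χ i = 1 then 1 else √(Fintype.card F) := by
  classical
  have hf0 : ∀ i, f i ≠ 0 := fun i => ne_zero_of_natDegree_gt (Nat.pos_of_ne_zero (hdeg i))
  set S : ℂ := ∑ c, ∏ i with χ i ≠ 1, χ i ((f i).eval c * ε i) with hS
  have hdiff : ‖∑ c, ∏ i, χ i ((f i).eval c * ε i) - S‖
      ≤ ∑ i with χ i = 1, ((f i).natDegree : ℝ) := by
    have hterm : ∀ c ∈ (Finset.univ : Finset F),
        ‖∏ i, χ i ((f i).eval c * ε i) - ∏ i with χ i ≠ 1, χ i ((f i).eval c * ε i)‖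
          ≤ ∑ i with χ i = 1, if c ∈ (f i).roots.toFinset then (1 : ℝ) else 0 := by
      intro c _
      rw [← Finset.prod_filter_mul_prod_filter_not Finset.univ (fun i => χ i = 1)]
      by_cases hc : ∃ i, χ i = 1 ∧ (f i).eval c = 0
      · obtain ⟨i, hi, hic⟩ := hc
        have hmem : i ∈ ({i | χ i = 1} : Finset ι) := by simpa using hi
        rw [Finset.prod_eq_zero hmem (by rw [hic, zero_mul, MulChar.map_zero]), zero_mul, zero_sub,
          norm_neg, norm_prod]
        calc ∏ i with χ i ≠ 1, ‖χ i ((f i).eval c * ε i)‖ ≤ 1 :=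
              Finset.prod_le_one (fun _ _ => norm_nonneg _) fun i _ => (χ i).norm_apply_le_one _
          _ = if c ∈ (f i).roots.toFinset then (1 : ℝ) else 0 := by
              rw [if_pos]
              rwa [Multiset.mem_toFinset, mem_roots (hf0 i)]
          _ ≤ _ := Finset.single_le_sum (f := fun i => if c ∈ (f i).roots.toFinset then (1 : ℝ)
              else 0) (fun j _ => by split_ifs <;> norm_num) hmem
      · push Not at hc
        rw [Finset.prod_eq_one, one_mul, sub_self, norm_zero]
        · exact Finset.sum_nonneg fun j _ => by split_ifs <;> norm_num
        · intro i hi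
          have hi1 : χ i = 1 := by simpa using hi
          rw [hi1, MulChar.one_apply (mul_ne_zero (hc i hi1) (hε i)).isUnit]
    rw [hS, ← Finset.sum_sub_distrib]
    refine (norm_sum_le_of_le _ hterm).trans ?_
    rw [Finset.sum_comm]
    refine Finset.sum_le_sum fun i _ => ?_
    rw [← Finset.sum_filter, Finset.sum_const, nsmul_one, Finset.filter_mem_eq_inter,
      Finset.univ_inter]
    exact_mod_cast (Multiset.toFinset_card_le _).trans (card_roots' _)
  have hmain : ‖S - if χ = 1 then (Fintype.card F : ℂ) else 0‖
      ≤ ∑ i with χ i ≠ 1, (f i).natDegree * √(Fintype.card F) := by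
    split_ifs with h1
    · subst h1
      simp [hS]
    · obtain ⟨i, hi⟩ := Function.ne_iff.mp h1
      have : Nonempty {i // χ i ≠ 1} := ⟨⟨i, hi⟩⟩
      have hsub : ∀ {M : Type} [CommMonoid M] (a : ι → M),
          ∏ i with χ i ≠ 1, a i = ∏ i : {i // χ i ≠ 1}, a i := fun a =>
        Finset.prod_subtype _ (fun x => by simp) a
      have key := norm_sum_prod_mulChar_eval_mul_le (f := fun i : {i // χ i ≠ 1} => f i)
        (χ := fun i => χ i) (ε := fun i => ε i) (fun i => hdeg i)
        (hsep.of_dvd ?_) (fun i => i.2) fun i => hε i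
      · rw [sub_zero, hS, ← Finset.sum_mul,
          Finset.sum_subtype _ (p := fun i => χ i ≠ 1) (fun x => by simp)]
        simp only [hsub]
        push_cast at key
        exact key
      · rw [← Finset.prod_subtype ({i | χ i ≠ 1} : Finset ι) (fun x => by simp) f]
        exact Finset.prod_dvd_prod_of_subset _ _ _ (Finset.filter_subset _ _)
  calc _ ≤ _ := norm_sub_le_norm_sub_add_norm_sub _ S _
    _ ≤ _ := add_le_add hdiff hmain
    _ = _ := by
      rw [← Finset.sum_filter_add_sum_filter_not Finset.univ (fun i => χ i = 1)
        (fun i => ((f i).natDegree : ℝ) * if χ i = 1 then 1 else √(Fintype.card F))]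
      congr 1
      · refine Finset.sum_congr rfl fun i hi => ?_
        rw [if_pos (Finset.mem_filter.mp hi).2, mul_one]
      · refine Finset.sum_congr rfl fun i hi => ?_
        rw [if_neg (Finset.mem_filter.mp hi).2]

lemma sum_piFinset_apply_le {ι κ : Type*} [Fintype ι] [DecidableEq ι] (t : ι → Finset κ)
    {r : ι → ℕ} (ht : ∀ i, (t i).card ≤ r i) {w : κ → ℝ} (hw0 : ∀ x, 0 ≤ w x) (i : ι) {b : ℝ}
    (hw : ∑ x ∈ t i, w x ≤ b) :
    ∑ x ∈ Fintype.piFinset t, w (x i) ≤ b * ∏ j ∈ Finset.univ.erase i, (r j : ℝ) := by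
  have h := Finset.prod_univ_sum t fun j x => if j = i then w x else 1
  simp only [Finset.prod_ite_eq', Finset.mem_univ, if_true] at h
  rw [← h, ← Finset.mul_prod_erase _ _ (Finset.mem_univ i)]
  simp only [if_true]
  refine mul_le_mul hw (Finset.prod_le_prod ?_ ?_) (Finset.prod_nonneg ?_)
    ((Finset.sum_nonneg fun x _ => hw0 x).trans hw)
  all_goals
    intro j hj
    simp only [if_neg (Finset.ne_of_mem_erase hj), Finset.sum_const, nsmul_one]
  · positivity
  · exact_mod_cast ht j
  · positivity

theorem exists_forall_pow_eq_eval_mul {ι : Type*} [Fintype F] [Fintype ι] {f : ι → F[X]}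
    (hdeg : ∀ i, (f i).natDegree ≠ 0) (hsep : (∏ i, f i).Separable) {ε : ι → F}
    (hε : ∀ i, ε i ≠ 0)
    (hq : ((∑ i, ((f i).natDegree - 1 : ℝ)) * √(Fintype.card F) + Fintype.card ι)
      * ∏ i, ((f i).natDegree : ℝ) < Fintype.card F) :
    ∃ c : F, ∀ i, ∃ y : Fˣ, (y : F) ^ (f i).natDegree = (f i).eval c * ε i := by
  classical
  by_contra! h
  set q : ℝ := (Fintype.card F : ℝ)
  set T : ι → Finset (MulChar F ℂ) := fun i => mulCharsPowEqOne F (f i).natDegree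
  have hcard : ∀ i, (T i).card ≤ (f i).natDegree := fun i => card_mulCharsPowEqOne_le (hdeg i)
  have hzero : ∑ χ ∈ Fintype.piFinset T, ∑ c, ∏ i, χ i ((f i).eval c * ε i) = 0 := by
    rw [Finset.sum_comm]
    refine Finset.sum_eq_zero fun c _ => ?_
    rw [← Finset.prod_univ_sum T fun i (χ : MulChar F ℂ) => χ ((f i).eval c * ε i)]
    obtain ⟨i, hi⟩ := h c
    refine Finset.prod_eq_zero (Finset.mem_univ i) ?_
    by_contra h0
    obtain ⟨y, hy⟩ := exists_pow_eq_of_sum_mulChar_ne_zero h0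
    exact hi y hy
  have hone : (1 : ι → MulChar F ℂ) ∈ Fintype.piFinset T :=
    Fintype.mem_piFinset.mpr fun i => one_mem_mulCharsPowEqOne _
  have hle : q ≤ ∑ χ ∈ Fintype.piFinset T,
      ∑ i, (f i).natDegree * if χ i = 1 then 1 else √(Fintype.card F) := by
    have hsum : ∑ χ ∈ Fintype.piFinset T, (∑ c, ∏ i, χ i ((f i).eval c * ε i)
        - if χ = 1 then (Fintype.card F : ℂ) else 0) = -(Fintype.card F : ℂ) := by
      rw [Finset.sum_sub_distrib, hzero, Finset.sum_ite_eq', if_pos hone, zero_sub]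
    calc q = ‖-(Fintype.card F : ℂ)‖ := by rw [norm_neg, Complex.norm_natCast]
      _ ≤ _ := by
        rw [← hsum]
        exact norm_sum_le_of_le _ fun χ _ => norm_sum_prod_mulChar_sub_le hdeg hsep hε χ
  have hw : ∀ i, ∑ χ ∈ T i, (if χ = 1 then 1 else √q) ≤ ((f i).natDegree - 1) * √q + 1 := by
    intro i
    rw [← Finset.add_sum_erase _ _ (one_mem_mulCharsPowEqOne _), if_pos rfl,
      Finset.sum_congr rfl fun χ hχ => if_neg (Finset.ne_of_mem_erase hχ), Finset.sum_const,
      nsmul_eq_mul, add_comm]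
    gcongr
    rw [le_sub_iff_add_le]
    have := Finset.card_erase_add_one (one_mem_mulCharsPowEqOne (F := F) (f i).natDegree)
    exact_mod_cast this.trans_le (hcard i)
  have hbound : ∑ χ ∈ Fintype.piFinset T, ∑ i, (f i).natDegree * (if χ i = 1 then 1 else √q)
      ≤ ((∑ i, ((f i).natDegree - 1 : ℝ)) * √q + Fintype.card ι)
        * ∏ i, ((f i).natDegree : ℝ) := by
    rw [Finset.sum_comm, Finset.sum_mul, ← Finset.card_univ, Finset.cast_card,
      ← Finset.sum_add_distrib, Finset.sum_mul]
    refine Finset.sum_le_sum fun i _ => ?_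
    rw [← Finset.mul_sum, ← Finset.mul_prod_erase _ _ (Finset.mem_univ i), mul_left_comm]
    gcongr
    exact sum_piFinset_apply_le T hcard (fun χ => by positivity) i (hw i)
  linarith

end PowerResidues

/-- Let `n` and `m` be fixed with `m ≥ 0`, and let `F` be a finite field.
Let `f₀, …, f_m ∈ F[x]` be polynomials whose product is separable, and let `r_i = deg f_i`.
Assume each `r_i` is coprime to `#F`, and that
`#F + 1 − 2·(1 + ½(∑ r_i − m − 3))·(∏ r_i)·√#F > (m + 2)·∏ r_i`.
Then for any `ε₀, …, ε_m ∈ F×` the set `{c ∈ F : f_i(c)·ε_i ∈ F^{×r_i} for all i}` is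
nonempty. -/
theorem stmt16 (n m : ℕ) (F : Type*) [Field F] [Fintype F]
    (f : Fin (m + 1) → Polynomial F)
    (hsep : (∏ i, f i).Separable)
    (r : Fin (m + 1) → ℕ) (hr : ∀ i, r i = (f i).natDegree)
    (hcop : ∀ i, Nat.Coprime (r i) (Fintype.card F))
    (hbig : (Fintype.card F : ℝ) + 1 -
          2 * (1 + (1 / 2 : ℝ) * ((∑ i, (r i : ℝ)) - m - 3)) * (∏ i, (r i : ℝ)) *
            Real.sqrt (Fintype.card F)
        > ((m : ℝ) + 2) * ∏ i, (r i : ℝ)) :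
    ∀ ε : Fin (m + 1) → Fˣ,
      {c : F | ∀ i, ∃ y : Fˣ, (y : F) ^ (r i) = (f i).eval c * (ε i : F)}.Nonempty := by
  intro ε
  obtain rfl : r = fun i => (f i).natDegree := funext hr
  have hdeg : ∀ i, (f i).natDegree ≠ 0 := by
    intro i h0
    have h1 := hcop i
    simp only [h0, Nat.coprime_zero_left] at h1
    exact Fintype.one_lt_card.ne' h1
  have hP : (1 : ℝ) ≤ ∏ i, ((f i).natDegree : ℝ) := by
    exact_mod_cast Nat.one_le_iff_ne_zero.mpr (Finset.prod_ne_zero_iff.mpr fun i _ => hdeg i)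
  refine exists_forall_pow_eq_eval_mul hdeg hsep (fun i => (ε i).ne_zero) ?_
  rw [Finset.sum_sub_distrib, Finset.sum_const, Finset.card_univ, Fintype.card_fin, nsmul_one]
  push_cast
  linarith
end
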